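/- arXiv:0810.5108 — 9 statements merged into one kernel-verified Lean document; each statement's English description precedes it below -/
import Mathlib

section
/- Every gate in the third level of the Clifford hierarchy is a generalized semi-Clifford operation: for every n ≥ 1 and every unitary U ∈ 𝒞_3 on H_n, there exist maximal abelian subgroups H and H' of the Pauli group P_n such that U · span_ℂ(H) · U† = span_ℂ(H'). -/
open Matrix

/-- The Pauli operator `τ_a` on `n` qubits, for `a = (v, w) ∈ Z_2^n × Z_2^n`
(the first summand indexes `v`, the second `w`):
`τ_a |x⟩ = (−1)^{v·(x+w)} |x+w⟩`. -/
noncomputable def tau (n : ℕ) (a : Fin n ⊕ Fin n → ZMod 2) :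
    Matrix (Fin n → ZMod 2) (Fin n → ZMod 2) ℂ :=
  Matrix.of fun y x =>
    if y = x + fun i => a (Sum.inr i) then
      (-1 : ℂ) ^ (((fun i => a (Sum.inl i)) ⬝ᵥ (x + fun i => a (Sum.inr i))).val)
    else 0

/-- The Pauli group `P_n`: all operators `i^δ (−1)^ε τ_a`. -/
def PauliGroup (n : ℕ) : Set (Matrix (Fin n → ZMod 2) (Fin n → ZMod 2) ℂ) :=
  { M | ∃ (δ ε : ZMod 2) (a : Fin n ⊕ Fin n → ZMod 2),
      M = (Complex.I ^ δ.val * (-1 : ℂ) ^ ε.val) • tau n a }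

def IsUnitaryMat {n : ℕ} (M : Matrix (Fin n → ZMod 2) (Fin n → ZMod 2) ℂ) : Prop :=
  M * Mᴴ = 1 ∧ Mᴴ * M = 1

/-- The Clifford group `𝒞_2`. -/
def Clifford2 (n : ℕ) : Set (Matrix (Fin n → ZMod 2) (Fin n → ZMod 2) ℂ) :=
  { Q | IsUnitaryMat Q ∧ ∀ σ ∈ PauliGroup n, Q * σ * Qᴴ ∈ PauliGroup n }

/-- The third level of the Clifford hierarchy `𝒞_3`. -/
def Clifford3 (n : ℕ) : Set (Matrix (Fin n → ZMod 2) (Fin n → ZMod 2) ℂ) :=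
  { U | IsUnitaryMat U ∧ ∀ σ ∈ PauliGroup n, U * σ * Uᴴ ∈ Clifford2 n }

/-- `H` is a subgroup of the set `G` (which is assumed to be a group of matrices). -/
def IsSubgroupOfSet {M : Type*} [Monoid M] (H G : Set M) : Prop :=
  H ⊆ G ∧ (1 : M) ∈ H ∧ (∀ a ∈ H, ∀ b ∈ H, a * b ∈ H) ∧
    ∀ a ∈ H, ∃ b ∈ H, a * b = 1 ∧ b * a = 1

/-- `H` is a maximal abelian subgroup of `G`: an abelian subgroup not properly
contained in any abelian subgroup of `G`. -/
def IsMaxAbelianSubgroup {M : Type*} [Monoid M] (H G : Set M) : Prop :=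
  IsSubgroupOfSet H G ∧ (∀ a ∈ H, ∀ b ∈ H, a * b = b * a) ∧
    ∀ H' : Set M, IsSubgroupOfSet H' G → (∀ a ∈ H', ∀ b ∈ H', a * b = b * a) →
      H ⊆ H' → H' = H


namespace C3Proof

/-- Fixed-point step: a `2`-group acting on a finite `2`-group has an invariant,
self-centralizing abelian subgroup. -/
theorem exists_invariant_maxabelian {G P : Type*} [Group G] [Group P] [Finite P]
    (hG : IsPGroup 2 G) (hP : IsPGroup 2 P) (φ : G →* MulAut P) :
    ∃ K : Subgroup P, (∀ a ∈ K, ∀ b ∈ K, a * b = b * a) ∧ (∀ g, ∀ k ∈ K, φ g k ∈ K) ∧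
      ∀ x, (∀ k ∈ K, k * x = x * k) → x ∈ K := by
  classical
  have : Fact (Nat.Prime 2) := ⟨Nat.prime_two⟩
  let S : Set (Subgroup P) :=
    {K | (∀ a ∈ K, ∀ b ∈ K, a * b = b * a) ∧ (∀ g, ∀ k ∈ K, φ g k ∈ K)}
  have hS : S.Nonempty := ⟨⊥, by
    constructor
    · intro a ha b hb
      rw [Subgroup.mem_bot] at ha hb
      rw [ha, hb]
    · intro g k hk
      rw [Subgroup.mem_bot] at hk ⊢
      rw [hk, map_one]⟩
  obtain ⟨K, hK⟩ := Set.Finite.exists_maximal (Set.toFinite S) hS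
  obtain ⟨hKc, hKi⟩ := hK.prop
  refine ⟨K, hKc, hKi, ?_⟩
  by_contra! hcon
  obtain ⟨x, hx, hxK⟩ := hcon
  let C : Subgroup P := Subgroup.centralizer (K : Set P)
  have hCi : ∀ g, ∀ c ∈ C, φ g c ∈ C := by
    intro g c hc
    rw [Subgroup.mem_centralizer_iff] at hc ⊢
    intro k hk
    have h1 := hc (φ g⁻¹ k) (hKi _ _ hk)
    have h2 := congrArg (φ g) h1
    have h3 : φ g (φ g⁻¹ k) = k := by
      rw [← MulAut.mul_apply, ← map_mul]; simp
    rwa [map_mul, map_mul, h3] at h2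
  let act : MulAction G C :=
    { smul := fun g c => ⟨φ g c, hCi g c c.2⟩
      one_smul := fun c => Subtype.ext (by
        change φ 1 (c : P) = c
        simp)
      mul_smul := fun g h c => Subtype.ext (by
        change φ (g * h) (c : P) = φ g (φ h c)
        simp) }
  have smul_def : ∀ (g : G) (c : C), ((g • c : C) : P) = φ g c := fun _ _ => rfl
  let K' : Subgroup C := K.subgroupOf C
  have qa : MulAction.QuotientAction G K' := ⟨by
    intro g a a' h
    rw [Subgroup.mem_subgroupOf] at h ⊢
    have := hKi g _ h
    simpa [smul_def] using this⟩
  have hne : K'.index ≠ 1 := by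
    intro h
    rw [Subgroup.index_eq_one] at h
    have : (⟨x, by rw [Subgroup.mem_centralizer_iff]; exact hx⟩ : C) ∈ K' := by
      rw [h]; trivial
    rw [Subgroup.mem_subgroupOf] at this
    exact hxK this
  have hdvd : 2 ∣ Nat.card (C ⧸ K') := by
    obtain ⟨m, hm⟩ := (hP.to_subgroup C).index K'
    change 2 ∣ K'.index
    rw [hm] at hne ⊢
    rcases m with _ | m
    · simp at hne
    · exact dvd_pow_self 2 (Nat.succ_ne_zero m)
  have h1 : ((1 : C) : C ⧸ K') ∈ MulAction.fixedPoints G (C ⧸ K') := by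
    intro g
    rw [MulAction.Quotient.smul_coe]
    congr 1
    apply Subtype.ext
    rw [smul_def]
    simp
  obtain ⟨b, hb, hbne⟩ :=
    hG.exists_fixed_point_of_prime_dvd_card_of_fixed_point (C ⧸ K') hdvd h1
  obtain ⟨c, rfl⟩ := QuotientGroup.mk_surjective b
  have hcK : (c : P) ∉ K := by
    intro h
    apply hbne
    rw [QuotientGroup.eq, Subgroup.mem_subgroupOf]
    simpa using h
  have hcfix : ∀ g, (c : P)⁻¹ * φ g c ∈ K := by
    intro g
    have h := hb g
    have h2 : ((g • c : C) : C ⧸ K') = (c : C ⧸ K') := by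
      rw [← MulAction.Quotient.smul_coe]; exact h
    have h3 := h2.symm
    rw [QuotientGroup.eq, Subgroup.mem_subgroupOf] at h3
    simpa [smul_def] using h3
  have hcC := Subgroup.mem_centralizer_iff.1 c.2
  let L : Subgroup P := Subgroup.closure ((K : Set P) ∪ {(c : P)})
  have hKL : K ≤ L := fun k hk => Subgroup.subset_closure (Or.inl hk)
  have hcL : (c : P) ∈ L := Subgroup.subset_closure (Or.inr rfl)
  have hL : L ∈ S := by
    constructor
    · have hcomm : ∀ a ∈ ((K : Set P) ∪ {(c : P)}), ∀ b ∈ ((K : Set P) ∪ {(c : P)}),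
          a * b = b * a := by
        rintro a (ha | rfl) b (hb | rfl)
        · exact hKc a ha b hb
        · exact hcC a ha
        · exact (hcC b hb).symm
        · rfl
      intro a ha b hb
      have h1 : L ≤ Subgroup.centralizer ((K : Set P) ∪ {(c : P)}) := by
        rw [Subgroup.closure_le]
        intro y hy
        rw [SetLike.mem_coe, Subgroup.mem_centralizer_iff]
        intro z hz
        exact hcomm z hz y hy
      have h2 : L ≤ Subgroup.centralizer (L : Set P) := by
        rw [Subgroup.closure_le]
        intro y hy
        rw [SetLike.mem_coe, Subgroup.mem_centralizer_iff]
        intro z hz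
        exact ((Subgroup.mem_centralizer_iff.1 (h1 hz)) y hy).symm
      exact (Subgroup.mem_centralizer_iff.1 (h2 hb)) a ha
    · intro g
      have : L ≤ L.comap (φ g).toMonoidHom := by
        rw [Subgroup.closure_le]
        rintro y (hy | rfl)
        · exact hKL (hKi g y hy)
        · change φ g c ∈ L
          have := L.mul_mem hcL (hKL (hcfix g))
          simpa using this
      exact fun k hk => this hk
  exact hcK (hK.le_of_ge hL hKL hcL)

/-- The sign character. -/
noncomputable def sgn (z : ZMod 2) : ℂ := (-1 : ℂ) ^ z.val

theorem sgn_zero : sgn 0 = 1 := by simp [sgn]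

theorem sgn_one : sgn 1 = -1 := by
  have : (1 : ZMod 2).val = 1 := rfl
  simp [sgn, this]

theorem z2_cases (a : ZMod 2) : a = 0 ∨ a = 1 := by
  revert a; decide

theorem z2_self (a : ZMod 2) : a + a = 0 := by
  revert a; decide

theorem sgn_add (a b : ZMod 2) : sgn (a + b) = sgn a * sgn b := by
  have h : (1 + 1 : ZMod 2) = 0 := by decide
  rcases z2_cases a with rfl | rfl <;> rcases z2_cases b with rfl | rfl <;>
    simp [sgn_zero, sgn_one, h]

theorem sgn_mul_self (a : ZMod 2) : sgn a * sgn a = 1 := by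
  rw [← sgn_add, z2_self, sgn_zero]

theorem star_sgn (a : ZMod 2) : star (sgn a) = sgn a := by
  simp [sgn]

theorem vec_self {ι : Type*} (a : ι → ZMod 2) : a + a = 0 := by
  funext i; exact z2_self _

theorem char_sum {ι : Type*} [Fintype ι] [DecidableEq ι] (d : ι → ZMod 2) :
    ∑ b : ι → ZMod 2, sgn (d ⬝ᵥ b) = if d = 0 then (2 : ℂ) ^ Fintype.card ι else 0 := by
  split_ifs with h
  · subst h
    simp [sgn_zero]
  · obtain ⟨i, hi⟩ : ∃ i, d i ≠ 0 := by
      by_contra! hh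
      exact h (funext hh)
    have hi1 : d i = 1 := (z2_cases (d i)).resolve_left hi
    have hs : ∑ b : ι → ZMod 2, sgn (d ⬝ᵥ b)
        = ∑ b : ι → ZMod 2, sgn (d ⬝ᵥ (b + Pi.single i 1)) := by
      symm
      refine Fintype.sum_equiv (Equiv.addRight (Pi.single i (1 : ZMod 2) : ι → ZMod 2)) _ _ ?_
      intro b
      rw [Equiv.coe_addRight]
    have hs2 : ∑ b : ι → ZMod 2, sgn (d ⬝ᵥ (b + Pi.single i 1))
        = - ∑ b : ι → ZMod 2, sgn (d ⬝ᵥ b) := by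
      rw [← Finset.sum_neg_distrib]
      refine Finset.sum_congr rfl fun b _ => ?_
      rw [dotProduct_add, sgn_add, dotProduct_single, hi1, mul_one, sgn_one]
      ring
    rw [hs2] at hs
    exact self_eq_neg.1 hs

variable {n : ℕ}

/-- The `v` part. -/
def vp (a : Fin n ⊕ Fin n → ZMod 2) : Fin n → ZMod 2 := fun i => a (Sum.inl i)
/-- The `w` part. -/
def wp (a : Fin n ⊕ Fin n → ZMod 2) : Fin n → ZMod 2 := fun i => a (Sum.inr i)

theorem vp_add (a b : Fin n ⊕ Fin n → ZMod 2) : vp (a + b) = vp a + vp b := rfl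
theorem wp_add (a b : Fin n ⊕ Fin n → ZMod 2) : wp (a + b) = wp a + wp b := rfl

theorem vec_shift {ι : Type*} (y x w : ι → ZMod 2) : y = x + w ↔ y + w = x := by
  constructor
  · rintro rfl; rw [add_assoc, vec_self, add_zero]
  · rintro rfl; rw [add_assoc, vec_self, add_zero]

theorem tau_apply (a : Fin n ⊕ Fin n → ZMod 2) (y x : Fin n → ZMod 2) :
    tau n a y x = if y + wp a = x then sgn (vp a ⬝ᵥ y) else 0 := by
  have h : tau n a y x = if y = x + wp a then sgn (vp a ⬝ᵥ (x + wp a)) else 0 := rfl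
  rw [h]
  by_cases hy : y = x + wp a
  · rw [if_pos hy, if_pos ((vec_shift _ _ _).1 hy), ← hy]
  · rw [if_neg hy, if_neg (fun h => hy ((vec_shift _ _ _).2 h))]

theorem tau_mul (a b : Fin n ⊕ Fin n → ZMod 2) :
    tau n a * tau n b = sgn (vp b ⬝ᵥ wp a) • tau n (a + b) := by
  ext y x
  have hR : (sgn (vp b ⬝ᵥ wp a) • tau n (a + b)) y x
      = sgn (vp b ⬝ᵥ wp a) * tau n (a + b) y x := rfl
  rw [hR, Matrix.mul_apply, Finset.sum_eq_single (y + wp a)]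
  · rw [tau_apply, tau_apply, tau_apply, if_pos rfl, wp_add, vp_add, add_assoc y (wp a) (wp b),
      dotProduct_add, add_dotProduct, sgn_add, sgn_add]
    by_cases h : y + (wp a + wp b) = x
    · rw [if_pos h, if_pos h]; ring
    · rw [if_neg h, if_neg h, mul_zero, mul_zero]
  · intro z _ hz
    rw [tau_apply, if_neg (Ne.symm hz), zero_mul]
  · intro h
    exact absurd (Finset.mem_univ _) h

theorem tau_zero : tau n 0 = 1 := by
  ext y x
  rw [tau_apply, Matrix.one_apply]
  have h1 : wp (0 : Fin n ⊕ Fin n → ZMod 2) = 0 := rfl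
  have h2 : vp (0 : Fin n ⊕ Fin n → ZMod 2) = 0 := rfl
  rw [h1, h2, add_zero, zero_dotProduct, sgn_zero]

theorem tau_star (a : Fin n ⊕ Fin n → ZMod 2) :
    (tau n a)ᴴ = sgn (vp a ⬝ᵥ wp a) • tau n a := by
  ext y x
  rw [Matrix.conjTranspose_apply, Matrix.smul_apply, tau_apply, tau_apply]
  by_cases h : x + wp a = y
  · have h' : y + wp a = x := by rw [← h, add_assoc, vec_self, add_zero]
    rw [if_pos h, if_pos h', star_sgn, smul_eq_mul, ← sgn_add, ← dotProduct_add, ← h', add_comm]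
  · have h' : ¬ (y + wp a = x) := fun h' => h (by rw [← h', add_assoc, vec_self, add_zero])
    rw [if_neg h, if_neg h', star_zero, smul_zero]

theorem tau_sq (a : Fin n ⊕ Fin n → ZMod 2) :
    tau n a * tau n a = sgn (vp a ⬝ᵥ wp a) • 1 := by
  rw [tau_mul, vec_self, tau_zero]

theorem tau_conj (b a : Fin n ⊕ Fin n → ZMod 2) :
    tau n b * tau n a * (tau n b)ᴴ = (sgn (vp a ⬝ᵥ wp b) * sgn (vp b ⬝ᵥ wp a)) • tau n a := by
  have h : b + a + b = a := by rw [add_comm b a, add_assoc, vec_self, add_zero]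
  rw [tau_star, tau_mul, smul_mul_smul_comm, tau_mul, h, smul_smul, wp_add, dotProduct_add, sgn_add]
  congr 1
  linear_combination (sgn (vp a ⬝ᵥ wp b) * sgn (vp b ⬝ᵥ wp a)) * sgn_mul_self (vp b ⬝ᵥ wp b)

theorem tau_comm (a b : Fin n ⊕ Fin n → ZMod 2) :
    ∃ e : ℂ, tau n a * tau n b = e • (tau n b * tau n a) := by
  refine ⟨sgn (vp b ⬝ᵥ wp a) * sgn (vp a ⬝ᵥ wp b), ?_⟩
  rw [tau_mul, tau_mul, smul_smul, add_comm b a, mul_assoc, sgn_mul_self, mul_one]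

theorem mem_pauli (M : Matrix (Fin n → ZMod 2) (Fin n → ZMod 2) ℂ) :
    M ∈ PauliGroup n ↔ ∃ c : ℂ, c ^ 4 = 1 ∧ ∃ a, M = c • tau n a := by
  constructor
  · rintro ⟨δ, ε, a, rfl⟩
    refine ⟨_, ?_, a, rfl⟩
    have h1 : (Complex.I ^ δ.val) ^ 4 = 1 := by
      rw [← pow_mul, mul_comm, pow_mul, Complex.I_pow_four, one_pow]
    have h2 : ((-1 : ℂ) ^ ε.val) ^ 4 = 1 := by
      rw [← pow_mul, mul_comm, pow_mul]; norm_num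
    rw [mul_pow, h1, h2, one_mul]
  · rintro ⟨c, hc, a, rfl⟩
    have h1 : (1 : ZMod 2).val = 1 := rfl
    have h : (c - 1) * ((c + 1) * ((c - Complex.I) * (c + Complex.I))) = 0 := by
      linear_combination hc - (c ^ 2 - 1) * Complex.I_sq
    rcases mul_eq_zero.1 h with h | h
    · exact ⟨0, 0, a, by rw [sub_eq_zero.1 h]; simp⟩
    rcases mul_eq_zero.1 h with h | h
    · exact ⟨0, 1, a, by rw [eq_neg_of_add_eq_zero_left h]; simp [h1]⟩
    rcases mul_eq_zero.1 h with h | h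
    · exact ⟨1, 0, a, by rw [sub_eq_zero.1 h]; simp [h1]⟩
    · exact ⟨1, 1, a, by rw [eq_neg_of_add_eq_zero_left h]; simp [h1]⟩

theorem tau_mem (a : Fin n ⊕ Fin n → ZMod 2) : tau n a ∈ PauliGroup n :=
  (mem_pauli _).2 ⟨1, by simp, a, by simp⟩

theorem sgn_pow_four (z : ZMod 2) : sgn z ^ 4 = 1 := by
  have := sgn_mul_self z
  linear_combination (sgn z ^ 2 + 1) * this

theorem pauli_one : (1 : Matrix (Fin n → ZMod 2) (Fin n → ZMod 2) ℂ) ∈ PauliGroup n := by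
  rw [← tau_zero]; exact tau_mem 0

theorem pauli_mul {A B : Matrix (Fin n → ZMod 2) (Fin n → ZMod 2) ℂ}
    (hA : A ∈ PauliGroup n) (hB : B ∈ PauliGroup n) : A * B ∈ PauliGroup n := by
  rw [mem_pauli] at *
  obtain ⟨c, hc, a, rfl⟩ := hA
  obtain ⟨d, hd, b, rfl⟩ := hB
  refine ⟨c * d * sgn (vp b ⬝ᵥ wp a), ?_, a + b, ?_⟩
  · rw [mul_pow, mul_pow, hc, hd, sgn_pow_four]; simp
  · rw [smul_mul_smul_comm, tau_mul, smul_smul]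

theorem pauli_star {A : Matrix (Fin n → ZMod 2) (Fin n → ZMod 2) ℂ}
    (hA : A ∈ PauliGroup n) : Aᴴ ∈ PauliGroup n := by
  rw [mem_pauli] at *
  obtain ⟨c, hc, a, rfl⟩ := hA
  refine ⟨star c * sgn (vp a ⬝ᵥ wp a), ?_, a, ?_⟩
  · rw [mul_pow, ← star_pow, hc, sgn_pow_four]; simp
  · rw [Matrix.conjTranspose_smul, tau_star, smul_smul]

theorem pauli_pow_four {A : Matrix (Fin n → ZMod 2) (Fin n → ZMod 2) ℂ}
    (hA : A ∈ PauliGroup n) : A ^ 4 = 1 := by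
  rw [mem_pauli] at hA
  obtain ⟨c, hc, a, rfl⟩ := hA
  have h : tau n a ^ 4 = 1 := by
    rw [show 4 = 2 * 2 from rfl, pow_mul, pow_two (tau n a), tau_sq, smul_pow, pow_two, sgn_mul_self]
    simp
  rw [smul_pow, hc, h, one_smul]

theorem pauli_unitary {A : Matrix (Fin n → ZMod 2) (Fin n → ZMod 2) ℂ}
    (hA : A ∈ PauliGroup n) : A * Aᴴ = 1 := by
  rw [mem_pauli] at hA
  obtain ⟨c, hc, a, rfl⟩ := hA
  have hn : ‖c‖ = 1 := Complex.norm_eq_one_of_pow_eq_one hc (by norm_num)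
  have hcc : c * star c = 1 := by
    have := Complex.mul_conj c
    rw [Complex.normSq_eq_norm_sq, hn] at this
    simpa using this
  rw [Matrix.conjTranspose_smul, smul_mul_smul_comm, hcc, tau_star, Matrix.mul_smul, tau_sq, one_smul,
    smul_smul, sgn_mul_self, one_smul]

theorem pauli_unitary' {A : Matrix (Fin n → ZMod 2) (Fin n → ZMod 2) ℂ}
    (hA : A ∈ PauliGroup n) : Aᴴ * A = 1 := mul_eq_one_comm.1 (pauli_unitary hA)

theorem pauli_comm {A B : Matrix (Fin n → ZMod 2) (Fin n → ZMod 2) ℂ}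
    (hA : A ∈ PauliGroup n) (hB : B ∈ PauliGroup n) : ∃ e : ℂ, A * B = e • (B * A) := by
  rw [mem_pauli] at *
  obtain ⟨c, hc, a, rfl⟩ := hA
  obtain ⟨d, hd, b, rfl⟩ := hB
  obtain ⟨e, he⟩ := tau_comm a b
  refine ⟨e, ?_⟩
  rw [smul_mul_smul_comm, smul_mul_smul_comm, he, smul_smul, smul_smul]
  congr 1
  ring

theorem pauli_finite : (PauliGroup n).Finite := by
  refine (Set.finite_range (fun p : ZMod 2 × ZMod 2 × (Fin n ⊕ Fin n → ZMod 2) =>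
    (Complex.I ^ p.1.val * (-1 : ℂ) ^ p.2.1.val) • tau n p.2.2)).subset ?_
  rintro M ⟨δ, ε, a, rfl⟩
  exact ⟨(δ, ε, a), rfl⟩

theorem exists_expansion (M : Matrix (Fin n → ZMod 2) (Fin n → ZMod 2) ℂ) :
    ∃ c : (Fin n ⊕ Fin n → ZMod 2) → ℂ, M = ∑ a, c a • tau n a := by
  have hspan : M ∈ Submodule.span ℂ (Set.range (tau n)) := by
    rw [Matrix.matrix_eq_sum_single M]
    refine Submodule.sum_mem _ fun y _ => Submodule.sum_mem _ fun x _ => ?_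
    have key : Matrix.single y x (M y x) = (M y x * ((2 : ℂ) ^ n)⁻¹) •
        ∑ v : Fin n → ZMod 2, sgn (v ⬝ᵥ y) • tau n (Sum.elim v (x + y)) := by
      ext y' x'
      have h1 : ∀ v : Fin n → ZMod 2, vp (Sum.elim v (x + y)) = v := fun _ => rfl
      have h2 : ∀ v : Fin n → ZMod 2, wp (Sum.elim v (x + y)) = x + y := fun _ => rfl
      rw [Matrix.smul_apply, Matrix.sum_apply]
      simp only [Matrix.smul_apply, tau_apply, h1, h2, smul_eq_mul, mul_ite, mul_zero,
        ← sgn_add, ← dotProduct_add]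
      have hc := char_sum (y + y')
      simp only [dotProduct_comm (y + y'), Fintype.card_fin] at hc
      have hz : y + y' = 0 ↔ y = y' := by
        constructor
        · intro h
          have := (vec_shift y 0 y').2 h
          rwa [zero_add] at this
        · rintro rfl; exact vec_self _
      by_cases hy : y = y'
      · subst hy
        rw [if_pos (vec_self y)] at hc
        have h3 : y + (x + y) = x := by rw [add_comm x y, ← add_assoc, vec_self, zero_add]
        simp only [h3]
        by_cases hx : x = x'
        · subst hx
          simp only [if_true, hc]
          rw [Matrix.single_apply_same]
          field_simp
        · simp [hx]
      · rw [if_neg (fun h => hy (hz.1 h))] at hc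
        rw [Matrix.single_apply_of_row_ne hy]
        split_ifs
        · rw [hc, mul_zero]
        · simp
    rw [key]
    exact Submodule.smul_mem _ _ (Submodule.sum_mem _ fun v _ =>
      Submodule.smul_mem _ _ (Submodule.subset_span ⟨_, rfl⟩))
  obtain ⟨c, hc⟩ := (Submodule.mem_span_range_iff_exists_fun ℂ).1 hspan
  exact ⟨c, hc.symm⟩

theorem conj_char_sum (a c : Fin n ⊕ Fin n → ZMod 2) :
    ∑ b : Fin n ⊕ Fin n → ZMod 2, (sgn (vp a ⬝ᵥ wp b) * sgn (vp b ⬝ᵥ wp a)) *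
      (sgn (vp c ⬝ᵥ wp b) * sgn (vp b ⬝ᵥ wp c)) =
      if c = a then (2 : ℂ) ^ (Fintype.card (Fin n ⊕ Fin n)) else 0 := by
  have hch := char_sum (Sum.elim (wp (a + c)) (vp (a + c)))
  have hz : (Sum.elim (wp (a + c)) (vp (a + c)) = 0) ↔ c = a := by
    constructor
    · intro h
      have h1 : a + c = 0 := by
        funext i
        rcases i with i | i
        · exact congrFun h (Sum.inr i)
        · exact congrFun h (Sum.inl i)
      rw [add_comm] at h1
      have := (vec_shift c 0 a).2 h1
      rwa [zero_add] at this
    · rintro rfl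
      rw [vec_self]
      funext i
      rcases i with i | i <;> rfl
  simp only [hz] at hch
  rw [← hch]
  refine Finset.sum_congr rfl fun b _ => ?_
  have hb : Sum.elim (wp (a + c)) (vp (a + c)) ⬝ᵥ b
      = wp (a + c) ⬝ᵥ vp b + vp (a + c) ⬝ᵥ wp b := by
    simp only [dotProduct, Fintype.sum_sum_type, Sum.elim_inl, Sum.elim_inr]
    rfl
  rw [hb, wp_add, vp_add, add_dotProduct, add_dotProduct, sgn_add, sgn_add, sgn_add,
    dotProduct_comm (wp a), dotProduct_comm (wp c)]
  ring

/-- A subspace stable under Pauli conjugation is spanned by the Paulis it contains. -/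
theorem stable_le_span (V : Submodule ℂ (Matrix (Fin n → ZMod 2) (Fin n → ZMod 2) ℂ))
    (hV : ∀ σ ∈ PauliGroup n, ∀ M ∈ V, σ * M * σᴴ ∈ V) :
    V ≤ Submodule.span ℂ ({M | M ∈ V ∧ M ∈ PauliGroup n}) := by
  intro M hM
  obtain ⟨c, hc⟩ := exists_expansion M
  have key : ∀ a, c a • tau n a ∈ V := by
    intro a
    have h1 : ∑ b : Fin n ⊕ Fin n → ZMod 2, (sgn (vp a ⬝ᵥ wp b) * sgn (vp b ⬝ᵥ wp a)) •
        (tau n b * M * (tau n b)ᴴ) ∈ V :=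
      Submodule.sum_mem _ fun b _ => Submodule.smul_mem _ _ (hV _ (tau_mem b) _ hM)
    have h2 : ∑ b : Fin n ⊕ Fin n → ZMod 2, (sgn (vp a ⬝ᵥ wp b) * sgn (vp b ⬝ᵥ wp a)) •
        (tau n b * M * (tau n b)ᴴ) = (2 : ℂ) ^ (Fintype.card (Fin n ⊕ Fin n)) • (c a • tau n a) := by
      have h3 : ∀ b : Fin n ⊕ Fin n → ZMod 2, (sgn (vp a ⬝ᵥ wp b) * sgn (vp b ⬝ᵥ wp a)) •
        (tau n b * M * (tau n b)ᴴ) = ∑ d, ((sgn (vp a ⬝ᵥ wp b) * sgn (vp b ⬝ᵥ wp a)) *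
          (sgn (vp d ⬝ᵥ wp b) * sgn (vp b ⬝ᵥ wp d))) • (c d • tau n d) := by
        intro b
        rw [hc, Finset.mul_sum, Finset.sum_mul, Finset.smul_sum]
        refine Finset.sum_congr rfl fun d _ => ?_
        rw [Matrix.mul_smul, Matrix.smul_mul, tau_conj, smul_smul, smul_smul, smul_smul]
        congr 1
        ring
      rw [Finset.sum_congr rfl fun b _ => h3 b, Finset.sum_comm]
      simp only [← Finset.sum_smul, conj_char_sum, ite_smul, zero_smul]
      rw [Finset.sum_ite_eq']
      simp
    rw [h2] at h1
    have h4 := Submodule.smul_mem V ((2 : ℂ) ^ (Fintype.card (Fin n ⊕ Fin n)))⁻¹ h1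
    rwa [smul_smul, inv_mul_cancel₀ (pow_ne_zero _ two_ne_zero), one_smul] at h4
  rw [hc]
  refine Submodule.sum_mem _ fun a _ => ?_
  by_cases h : c a = 0
  · rw [h, zero_smul]; exact Submodule.zero_mem _
  · refine Submodule.smul_mem _ _ (Submodule.subset_span ⟨?_, tau_mem a⟩)
    have := Submodule.smul_mem V (c a)⁻¹ (key a)
    rwa [smul_smul, inv_mul_cancel₀ h, one_smul] at this

/-- The Pauli group as a subgroup of the unitary group. -/
def pauliSub (n : ℕ) : Subgroup (Matrix.unitaryGroup (Fin n → ZMod 2) ℂ) where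
  carrier := {u | (u : Matrix (Fin n → ZMod 2) (Fin n → ZMod 2) ℂ) ∈ PauliGroup n}
  one_mem' := pauli_one
  mul_mem' := fun ha hb => pauli_mul ha hb
  inv_mem' := fun ha => pauli_star ha

theorem isMax_of {H : Set (Matrix (Fin n → ZMod 2) (Fin n → ZMod 2) ℂ)}
    (hP : H ⊆ PauliGroup n) (h1 : 1 ∈ H) (hm : ∀ a ∈ H, ∀ b ∈ H, a * b ∈ H)
    (hc : ∀ a ∈ H, ∀ b ∈ H, a * b = b * a)
    (hmax : ∀ x ∈ PauliGroup n, (∀ h ∈ H, h * x = x * h) → x ∈ H) :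
    IsMaxAbelianSubgroup H (PauliGroup n) := by
  refine ⟨⟨hP, h1, hm, ?_⟩, hc, ?_⟩
  · intro a ha
    refine ⟨a * (a * a), hm _ ha _ (hm _ ha _ ha), ?_, ?_⟩
    · rw [← pauli_pow_four (hP ha)]; noncomm_ring
    · rw [← pauli_pow_four (hP ha)]; noncomm_ring
  · intro H' hH' hc' hsub
    refine Set.Subset.antisymm (fun x hx => ?_) hsub
    exact hmax x (hH'.1 hx) fun h hh => hc' h (hsub hh) x hx

theorem exists_H' (U : Matrix (Fin n → ZMod 2) (Fin n → ZMod 2) ℂ) (hU : U ∈ Clifford3 n) :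
    ∃ H : Set (Matrix (Fin n → ZMod 2) (Fin n → ZMod 2) ℂ), H ⊆ PauliGroup n ∧ 1 ∈ H ∧
      (∀ a ∈ H, ∀ b ∈ H, a * b ∈ H) ∧ (∀ a ∈ H, ∀ b ∈ H, a * b = b * a) ∧
      (∀ σ ∈ PauliGroup n, ∀ h ∈ H, (U * σ * Uᴴ) * h * (U * σ * Uᴴ)ᴴ ∈ H) ∧
      (∀ x ∈ PauliGroup n, (∀ h ∈ H, h * x = x * h) → x ∈ H) := by
  let u : Matrix.unitaryGroup (Fin n → ZMod 2) ℂ := ⟨U, Matrix.mem_unitaryGroup_iff.2 hU.1.1⟩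
  have hfin : Finite (pauliSub n) := by
    have : (pauliSub n : Set (Matrix.unitaryGroup (Fin n → ZMod 2) ℂ)).Finite :=
      (pauli_finite (n := n)).preimage (f := Subtype.val) Subtype.val_injective.injOn
    exact this
  have hP : IsPGroup 2 (pauliSub n) := by
    intro g
    refine ⟨2, ?_⟩
    apply Subtype.ext
    apply Subtype.ext
    have := pauli_pow_four g.2
    simpa using this
  let G : Subgroup (Matrix.unitaryGroup (Fin n → ZMod 2) ℂ) :=
    (pauliSub n).map (MulAut.conj u).toMonoidHom
  have hG : IsPGroup 2 G := hP.map _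
  have hconj : ∀ g ∈ G, ∀ p ∈ pauliSub n, g * p * g⁻¹ ∈ pauliSub n := by
    rintro _ ⟨q, hq, rfl⟩ p hp
    exact (hU.2 _ hq).2 _ hp
  have hGn : G ≤ Subgroup.normalizer (pauliSub n : Set _) := by
    intro g hg
    rw [Subgroup.mem_normalizer_iff]
    intro p
    refine ⟨hconj g hg p, fun h => ?_⟩
    have := hconj g⁻¹ (G.inv_mem hg) _ h
    simpa [mul_assoc] using this
  let φ : G →* MulAut (pauliSub n) :=
    (pauliSub n).normalizerMonoidHom.comp (Subgroup.inclusion hGn)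
  obtain ⟨K, hK1, hK2, hK3⟩ := exists_invariant_maxabelian hG hP φ
  refine ⟨{M | ∃ k ∈ K, ((k : Matrix.unitaryGroup (Fin n → ZMod 2) ℂ) :
      Matrix (Fin n → ZMod 2) (Fin n → ZMod 2) ℂ) = M}, ?_, ?_, ?_, ?_, ?_, ?_⟩
  · rintro _ ⟨k, hk, rfl⟩
    exact k.2
  · exact ⟨1, K.one_mem, rfl⟩
  · rintro _ ⟨k, hk, rfl⟩ _ ⟨l, hl, rfl⟩
    exact ⟨k * l, K.mul_mem hk hl, rfl⟩
  · rintro _ ⟨k, hk, rfl⟩ _ ⟨l, hl, rfl⟩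
    exact congrArg (fun z : pauliSub n => ((z : Matrix.unitaryGroup (Fin n → ZMod 2) ℂ) :
      Matrix (Fin n → ZMod 2) (Fin n → ZMod 2) ℂ)) (hK1 k hk l hl)
  · rintro σ hσ _ ⟨k, hk, rfl⟩
    let s : Matrix.unitaryGroup (Fin n → ZMod 2) ℂ :=
      ⟨σ, Matrix.mem_unitaryGroup_iff.2 (pauli_unitary hσ)⟩
    have hs : s ∈ pauliSub n := hσ
    exact ⟨_, hK2 ⟨MulAut.conj u s, ⟨s, hs, rfl⟩⟩ k hk, rfl⟩
  · intro x hx h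
    let s : Matrix.unitaryGroup (Fin n → ZMod 2) ℂ :=
      ⟨x, Matrix.mem_unitaryGroup_iff.2 (pauli_unitary hx)⟩
    have hs : s ∈ pauliSub n := hx
    refine ⟨⟨s, hs⟩, hK3 _ fun k hk => ?_, rfl⟩
    apply Subtype.ext
    apply Subtype.ext
    exact h _ ⟨k, hk, rfl⟩

theorem span_mul_closed {H : Set (Matrix (Fin n → ZMod 2) (Fin n → ZMod 2) ℂ)}
    (hm : ∀ a ∈ H, ∀ b ∈ H, a * b ∈ H) {x y : Matrix (Fin n → ZMod 2) (Fin n → ZMod 2) ℂ}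
    (hx : x ∈ Submodule.span ℂ H) (hy : y ∈ Submodule.span ℂ H) : x * y ∈ Submodule.span ℂ H := by
  have h := Submodule.mul_mem_mul hx hy
  rw [Submodule.span_mul_span] at h
  refine Submodule.span_mono ?_ h
  rintro _ ⟨a, ha, b, hb, rfl⟩
  exact hm a ha b hb

theorem comm_span {H : Set (Matrix (Fin n → ZMod 2) (Fin n → ZMod 2) ℂ)}
    {x y : Matrix (Fin n → ZMod 2) (Fin n → ZMod 2) ℂ}
    (hx : ∀ h ∈ H, h * x = x * h) (hy : y ∈ Submodule.span ℂ H) : y * x = x * y := by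
  induction hy using Submodule.span_induction with
  | mem z hz => exact hx z hz
  | zero => simp
  | add a b _ _ ha hb => rw [add_mul, mul_add, ha, hb]
  | smul c a _ ha => rw [Matrix.smul_mul, Matrix.mul_smul, ha]

theorem commutant {H : Set (Matrix (Fin n → ZMod 2) (Fin n → ZMod 2) ℂ)}
    (hP : H ⊆ PauliGroup n)
    (hmax : ∀ x ∈ PauliGroup n, (∀ h ∈ H, h * x = x * h) → x ∈ H)
    {M : Matrix (Fin n → ZMod 2) (Fin n → ZMod 2) ℂ} (hM : ∀ h ∈ H, h * M = M * h) :
    M ∈ Submodule.span ℂ H := by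
  let V : Submodule ℂ (Matrix (Fin n → ZMod 2) (Fin n → ZMod 2) ℂ) :=
    { carrier := {M | ∀ h ∈ H, h * M = M * h}
      zero_mem' := by intro h _; simp
      add_mem' := by
        intro a b ha hb h hh
        rw [mul_add, add_mul, ha h hh, hb h hh]
      smul_mem' := by
        intro c a ha h hh
        rw [Matrix.mul_smul, Matrix.smul_mul, ha h hh] }
  have hV : ∀ σ ∈ PauliGroup n, ∀ M ∈ V, σ * M * σᴴ ∈ V := by
    intro σ hσ M hM h hh
    obtain ⟨e, he⟩ := pauli_comm (hP hh) hσ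
    have h2 : σᴴ * h = e • (h * σᴴ) := by
      calc σᴴ * h = σᴴ * (h * σ) * σᴴ := by
            rw [mul_assoc, mul_assoc, pauli_unitary hσ, mul_one]
        _ = e • (h * σᴴ) := by
            rw [he, Matrix.mul_smul, ← mul_assoc, pauli_unitary' hσ, one_mul, Matrix.smul_mul]
    calc h * (σ * M * σᴴ) = (h * σ) * M * σᴴ := by simp only [mul_assoc]
      _ = e • (σ * (h * M) * σᴴ) := by rw [he]; simp only [Matrix.smul_mul, mul_assoc]
      _ = σ * M * (e • (h * σᴴ)) := by
          rw [hM h hh]; simp only [Matrix.mul_smul, mul_assoc]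
      _ = σ * M * σᴴ * h := by rw [← h2]; simp only [mul_assoc]
  refine Submodule.span_mono ?_ (stable_le_span V hV hM)
  rintro x ⟨hx1, hx2⟩
  exact hmax x hx2 hx1

end C3Proof

/-- Every gate in the third level of the Clifford hierarchy is generalized
semi-Clifford: there are maximal abelian subgroups `H, H'` of the Pauli group
with `U · span_ℂ(H) · U† = span_ℂ(H')`. -/
theorem c3_generalized_semiClifford (n : ℕ) (hn : 1 ≤ n)
    (U : Matrix (Fin n → ZMod 2) (Fin n → ZMod 2) ℂ) (hU : U ∈ Clifford3 n) :
    ∃ H H' : Set (Matrix (Fin n → ZMod 2) (Fin n → ZMod 2) ℂ),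
      IsMaxAbelianSubgroup H (PauliGroup n) ∧
      IsMaxAbelianSubgroup H' (PauliGroup n) ∧
      Submodule.map (LinearMap.mulRight ℂ Uᴴ ∘ₗ LinearMap.mulLeft ℂ U)
        (Submodule.span ℂ H) = Submodule.span ℂ H' := by
  obtain ⟨H', hP, h1, hm, hc, hinv, hmax⟩ := C3Proof.exists_H' U hU
  have hUU : U * Uᴴ = 1 := hU.1.1
  have hUU' : Uᴴ * U = 1 := hU.1.2
  let f : Matrix (Fin n → ZMod 2) (Fin n → ZMod 2) ℂ →ₗ[ℂ]
      Matrix (Fin n → ZMod 2) (Fin n → ZMod 2) ℂ :=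
    LinearMap.mulRight ℂ Uᴴ ∘ₗ LinearMap.mulLeft ℂ U
  have hf : ∀ M, f M = U * M * Uᴴ := fun M => rfl
  have hfm : ∀ M N, f (M * N) = f M * f N := by
    intro M N
    rw [hf, hf, hf]
    calc U * (M * N) * Uᴴ = U * M * (1 * N) * Uᴴ := by simp only [one_mul, mul_assoc]
      _ = U * M * Uᴴ * (U * N * Uᴴ) := by rw [← hUU']; simp only [mul_assoc]
  have hf1 : f 1 = 1 := by rw [hf, mul_one, hUU]
  have hfinj : ∀ M N, f M = f N → M = N := by
    intro M N h
    have h2 : ∀ M, Uᴴ * f M * U = M := by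
      intro M
      calc Uᴴ * f M * U = (Uᴴ * U) * M * (Uᴴ * U) := by rw [hf]; simp only [mul_assoc]
        _ = M := by rw [hUU', one_mul, mul_one]
    rw [← h2 M, ← h2 N, h]
  have hfsurj : ∀ M, f (Uᴴ * M * U) = M := by
    intro M
    calc f (Uᴴ * M * U) = (U * Uᴴ) * M * (U * Uᴴ) := by rw [hf]; simp only [mul_assoc]
      _ = M := by rw [hUU, one_mul, mul_one]
  obtain ⟨V, hVdef⟩ : ∃ V, V = (Submodule.span ℂ H').comap f := ⟨_, rfl⟩
  have memV : ∀ M, M ∈ V ↔ f M ∈ Submodule.span ℂ H' := by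
    intro M
    rw [hVdef, Submodule.mem_comap]
  have hV : ∀ σ ∈ PauliGroup n, ∀ M ∈ V, σ * M * σᴴ ∈ V := by
    intro σ hσ M hM
    have hM' : f M ∈ Submodule.span ℂ H' := (memV M).1 hM
    rw [memV]
    have hs : f σᴴ = (U * σ * Uᴴ)ᴴ := by
      rw [hf, Matrix.conjTranspose_mul, Matrix.conjTranspose_mul, Matrix.conjTranspose_conjTranspose,
        mul_assoc]
    rw [hfm, hfm, hs, hf σ]
    generalize f M = N at hM'
    induction hM' using Submodule.span_induction with
    | mem z hz => exact Submodule.subset_span (hinv σ hσ z hz)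
    | zero => simp
    | add a b _ _ ha hb => rw [mul_add, add_mul]; exact Submodule.add_mem _ ha hb
    | smul c a _ ha => rw [Matrix.mul_smul, Matrix.smul_mul]; exact Submodule.smul_mem _ _ ha
  have hspan := C3Proof.stable_le_span V hV
  have hmap : Submodule.map f (Submodule.span ℂ {M | M ∈ V ∧ M ∈ PauliGroup n})
      = Submodule.span ℂ H' := by
    apply le_antisymm
    · rw [Submodule.map_le_iff_le_comap, Submodule.span_le]
      exact fun M hM => (memV M).1 hM.1
    · intro M hM
      refine ⟨Uᴴ * M * U, hspan ?_, hfsurj M⟩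
      rwa [memV, hfsurj]
  refine ⟨{M | M ∈ V ∧ M ∈ PauliGroup n}, H', ?_, C3Proof.isMax_of hP h1 hm hc hmax, hmap⟩
  refine C3Proof.isMax_of (fun M hM => hM.2) ⟨?_, C3Proof.pauli_one⟩ ?_ ?_ ?_
  · rw [memV, hf1]
    exact Submodule.subset_span h1
  · intro a ha b hb
    refine ⟨?_, C3Proof.pauli_mul ha.2 hb.2⟩
    rw [memV, hfm]
    exact C3Proof.span_mul_closed hm ((memV _).1 ha.1) ((memV _).1 hb.1)
  · intro a ha b hb
    apply hfinj
    rw [hfm, hfm]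
    exact C3Proof.comm_span (fun h hh =>
      (C3Proof.comm_span (fun k hk => hc k hk h hh) ((memV _).1 hb.1)).symm) ((memV _).1 ha.1)
  · intro x hx hcom
    refine ⟨?_, hx⟩
    rw [memV]
    apply C3Proof.commutant hP hmax
    intro h hh
    have h3 : h ∈ Submodule.map f (Submodule.span ℂ {M | M ∈ V ∧ M ∈ PauliGroup n}) := by
      rw [hmap]; exact Submodule.subset_span hh
    obtain ⟨m, hm1, rfl⟩ := h3
    rw [← hfm, ← hfm, C3Proof.comm_span hcom hm1]
end

section
/- Let G be a subgroup of the Clifford group 𝒞_2 on n qubits which is isomorphic, as an abstract group, to the Pauli group P_n. Then there exist a maximal abelian subgroup H of G and a maximal abelian subgroup H' of P_n such that span_ℂ(H) = span_ℂ(H'). -/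
open Matrix

section GroupPart

/-! ### Group theory: an invariant self-centralizing abelian subgroup -/

variable {U : Type*} [Group U]

theorem exists_invariant_coset (P Γ A : Subgroup U) [Finite P] (hP : IsPGroup 2 P)
    (hΓ : IsPGroup 2 Γ) (hnorm : ∀ g ∈ Γ, ∀ p ∈ P, g * p * g⁻¹ ∈ P)
    (hAinv : ∀ g ∈ Γ, ∀ a ∈ A, g * a * g⁻¹ ∈ A)
    (hne : ∃ p ∈ P, (∀ a ∈ A, p * a = a * p) ∧ p ∉ A) :
    ∃ c ∈ P, (∀ a ∈ A, c * a = a * c) ∧ c ∉ A ∧ ∀ g ∈ Γ, c⁻¹ * (g * c * g⁻¹) ∈ A := by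
  classical
  let C : Subgroup U := P ⊓ Subgroup.centralizer (A : Set U)
  have memC : ∀ x, x ∈ C ↔ x ∈ P ∧ ∀ a ∈ A, a * x = x * a := by
    intro x
    simp only [C, Subgroup.mem_inf, Subgroup.mem_centralizer_iff, SetLike.mem_coe]
  have hCconj : ∀ g ∈ Γ, ∀ c ∈ C, g * c * g⁻¹ ∈ C := by
    intro g hg c hc
    rw [memC] at hc ⊢
    refine ⟨hnorm g hg c hc.1, fun a ha => ?_⟩
    have h1 := hc.2 (g⁻¹ * a * g) (by simpa using hAinv g⁻¹ (Γ.inv_mem hg) a ha)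
    calc a * (g * c * g⁻¹) = g * ((g⁻¹ * a * g) * c) * g⁻¹ := by group
      _ = g * (c * (g⁻¹ * a * g)) * g⁻¹ := by rw [h1]
      _ = g * c * g⁻¹ * a := by group
  let A' : Subgroup C := A.subgroupOf C
  have : Finite C := Finite.of_injective (Subgroup.inclusion (inf_le_left : C ≤ P))
    (Subgroup.inclusion_injective _)
  have hCp : IsPGroup 2 C := hP.to_le inf_le_left
  let act : Γ → (C ⧸ A') → (C ⧸ A') := fun g =>
    Quotient.map' (fun c => (⟨g * c * (g : U)⁻¹, hCconj g g.2 c c.2⟩ : C)) (by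
      intro a b hab
      rw [QuotientGroup.leftRel_apply] at hab ⊢
      simp only [A', Subgroup.mem_subgroupOf] at hab ⊢
      have := hAinv g g.2 _ hab
      convert this using 1
      simp only [Subgroup.coe_mul, Subgroup.coe_inv]
      group)
  let _ : MulAction Γ (C ⧸ A') :=
    { smul := act
      one_smul := by
        intro x
        induction x using Quotient.inductionOn' with
        | h c =>
          change act 1 _ = _
          simp [act, Quotient.map'_mk'']
      mul_smul := by
        intro g h x
        induction x using Quotient.inductionOn' with
        | h c =>
          change act (g * h) _ = act g (act h _)
          simp only [act, Quotient.map'_mk'']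
          congr 2
          simp only [Subgroup.coe_mul]
          group }
  have hsm : ∀ (g : Γ) (c : C), g • (QuotientGroup.mk c : C ⧸ A') =
      QuotientGroup.mk (⟨g * c * (g : U)⁻¹, hCconj g g.2 c c.2⟩ : C) := fun g c => rfl
  have hone : (QuotientGroup.mk (1 : C) : C ⧸ A') ∈ MulAction.fixedPoints Γ (C ⧸ A') := by
    intro g
    rw [hsm]
    congr 1
    ext
    simp
  have hdvd : 2 ∣ Nat.card (C ⧸ A') := by
    obtain ⟨k, hk⟩ := (IsPGroup.iff_card).1 hCp
    have h1 : A'.index ∣ 2 ^ k := hk ▸ A'.index_dvd_card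
    obtain ⟨j, -, hj⟩ := (Nat.dvd_prime_pow Nat.prime_two).1 h1
    change 2 ∣ A'.index
    rw [hj]
    rcases Nat.eq_zero_or_pos j with rfl | hpos
    · exfalso
      rw [pow_zero, Subgroup.index_eq_one] at hj
      obtain ⟨p, hp, hpc, hpA⟩ := hne
      have : (⟨p, (memC p).2 ⟨hp, fun a ha => (hpc a ha).symm⟩⟩ : C) ∈ A' := by
        rw [hj]; trivial
      exact hpA this
    · exact dvd_pow_self 2 hpos.ne'
  obtain ⟨b, hb, hne'⟩ := hΓ.exists_fixed_point_of_prime_dvd_card_of_fixed_point _ hdvd hone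
  obtain ⟨c, rfl⟩ := QuotientGroup.mk_surjective b
  have hc := (memC c).1 c.2
  refine ⟨c, hc.1, fun a ha => (hc.2 a ha).symm, ?_, ?_⟩
  · intro hcA
    apply hne'
    rw [QuotientGroup.eq]
    simpa [A', Subgroup.mem_subgroupOf] using hcA
  · intro g hg
    have h1 := hb ⟨g, hg⟩
    rw [hsm, eq_comm, QuotientGroup.eq] at h1
    simpa [A', Subgroup.mem_subgroupOf] using h1

theorem exists_invariant_selfcentralizing (P Γ : Subgroup U) [Finite P] (hP : IsPGroup 2 P)
    (hΓ : IsPGroup 2 Γ) (hnorm : ∀ g ∈ Γ, ∀ p ∈ P, g * p * g⁻¹ ∈ P) :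
    ∃ A : Subgroup U, A ≤ P ∧ (∀ g ∈ Γ, ∀ a ∈ A, g * a * g⁻¹ ∈ A) ∧
      (∀ a ∈ A, ∀ b ∈ A, a * b = b * a) ∧
      ∀ p ∈ P, (∀ a ∈ A, p * a = a * p) → p ∈ A := by
  classical
  let S : Set (Subgroup U) := {A | A ≤ P ∧ (∀ g ∈ Γ, ∀ a ∈ A, g * a * g⁻¹ ∈ A) ∧
      (∀ a ∈ A, ∀ b ∈ A, a * b = b * a)}
  have hfin : S.Finite := by
    have h : (Set.univ : Set (Subgroup P)).Finite := Set.toFinite _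
    refine (h.image (fun K => K.map P.subtype)).subset ?_
    intro A hA
    refine ⟨A.subgroupOf P, trivial, ?_⟩
    simpa using hA.1
  have hne : S.Nonempty := by
    refine ⟨⊥, bot_le, ?_, ?_⟩
    · intro g _ a ha
      rw [Subgroup.mem_bot] at ha ⊢
      simp [ha]
    · intro a ha b hb
      rw [Subgroup.mem_bot] at ha hb
      simp [ha, hb]
  obtain ⟨A, hAmax⟩ := hfin.exists_maximal hne
  obtain ⟨hAP, hAinv, hAcomm⟩ := hAmax.prop
  refine ⟨A, hAP, hAinv, hAcomm, ?_⟩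
  by_contra! hcon
  obtain ⟨c, hcP, hcA, hcn, hcinv⟩ :=
    exists_invariant_coset P Γ A hP hΓ hnorm hAinv hcon
  let B : Subgroup U := Subgroup.closure (insert c (A : Set U))
  have hAB : A ≤ B := fun a ha => Subgroup.subset_closure (Set.mem_insert_of_mem _ ha)
  have hcB : c ∈ B := Subgroup.subset_closure (Set.mem_insert _ _)
  have hBS : B ∈ S := by
    refine ⟨?_, ?_, ?_⟩
    · refine (Subgroup.closure_le _).2 ?_
      rintro x (rfl | hx)
      · exact hcP
      · exact hAP hx
    · intro g hg
      have : B ≤ B.comap (MulAut.conj g).toMonoidHom := by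
        refine (Subgroup.closure_le _).2 ?_
        rintro x (rfl | hx)
        · simp only [SetLike.mem_coe, Subgroup.mem_comap]
          change g * x * g⁻¹ ∈ B
          have h2 := B.mul_mem hcB (hAB (hcinv g hg))
          simpa [mul_assoc] using h2
        · simp only [SetLike.mem_coe, Subgroup.mem_comap]
          exact hAB (hAinv g hg x hx)
      intro a ha
      exact this ha
    · have hgen : ∀ x ∈ insert c (A : Set U), ∀ y ∈ insert c (A : Set U), x * y = y * x := by
        rintro x (rfl | hx) y (rfl | hy)
        · rfl
        · exact hcA y hy
        · exact (hcA x hx).symm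
        · exact hAcomm x hx y hy
      have h1 : B ≤ Subgroup.centralizer (insert c (A : Set U)) := by
        refine (Subgroup.closure_le _).2 ?_
        intro x hx
        rw [SetLike.mem_coe, Subgroup.mem_centralizer_iff]
        intro y hy
        exact hgen y hy x hx
      have h2 : B ≤ Subgroup.centralizer (B : Set U) := by
        refine (Subgroup.closure_le _).2 ?_
        intro x hx
        rw [SetLike.mem_coe, Subgroup.mem_centralizer_iff]
        intro y hy
        exact ((Subgroup.mem_centralizer_iff.1 (h1 hy)) x hx).symm
      intro a ha b hb
      exact (Subgroup.mem_centralizer_iff.1 (h2 hb)) a ha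
  exact hcn (hAmax.le_of_ge hBS hAB hcB)

end GroupPart

/-! ### Averaging over a finite group of units -/

section Averaging

open scoped ComplexOrder

variable {m : Type*} [Fintype m] [DecidableEq m]

theorem mat_eq_zero_of_eq_neg (x : Matrix m m ℂ) (h : x = -x) : x = 0 := by
  ext i j
  have h1 := congrFun (congrFun h i) j
  rw [Matrix.neg_apply] at h1
  exact self_eq_neg.1 h1

/-- Unnormalized averaging by conjugation. -/
noncomputable def avg (A : Subgroup (Matrix m m ℂ)ˣ) [Fintype A] :
    Matrix m m ℂ →ₗ[ℂ] Matrix m m ℂ where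
  toFun x := ∑ a : A, ((a : (Matrix m m ℂ)ˣ) : Matrix m m ℂ) * x *
    (((a : (Matrix m m ℂ)ˣ)⁻¹ : (Matrix m m ℂ)ˣ) : Matrix m m ℂ)
  map_add' x y := by simp [mul_add, add_mul, Finset.sum_add_distrib]
  map_smul' c x := by simp [Finset.smul_sum]

variable (A : Subgroup (Matrix m m ℂ)ˣ) [Fintype A]

theorem avg_apply (x : Matrix m m ℂ) : avg A x =
    ∑ a : A, ((a : (Matrix m m ℂ)ˣ) : Matrix m m ℂ) * x *
    (((a : (Matrix m m ℂ)ˣ)⁻¹ : (Matrix m m ℂ)ˣ) : Matrix m m ℂ) := rfl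

theorem avg_conj (b : (Matrix m m ℂ)ˣ) (hb : b ∈ A) (x : Matrix m m ℂ) :
    avg A ((b : Matrix m m ℂ) * x * ((b⁻¹ : (Matrix m m ℂ)ˣ) : Matrix m m ℂ)) = avg A x := by
  rw [avg_apply, avg_apply]
  refine Fintype.sum_equiv (Equiv.mulRight (⟨b, hb⟩ : A)) _ _ ?_
  intro a
  simp [mul_assoc]

theorem conj_avg (g : (Matrix m m ℂ)ˣ) (hg : ∀ a ∈ A, g * a * g⁻¹ ∈ A)
    (x : Matrix m m ℂ) :
    (g : Matrix m m ℂ) * avg A x * ((g⁻¹ : (Matrix m m ℂ)ˣ) : Matrix m m ℂ) =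
      avg A ((g : Matrix m m ℂ) * x * ((g⁻¹ : (Matrix m m ℂ)ˣ) : Matrix m m ℂ)) := by
  classical
  rw [avg_apply, avg_apply, Finset.mul_sum, Finset.sum_mul]
  let f : A → A := fun a => ⟨g * a * g⁻¹, hg a a.2⟩
  have hf : Function.Injective f := by
    intro a b hab
    have := congrArg (Subtype.val) hab
    simpa [f] using this
  refine Fintype.sum_bijective f (Finite.injective_iff_bijective.1 hf) _ _ ?_
  intro a
  simp [f, mul_assoc]

theorem avg_comm (b : (Matrix m m ℂ)ˣ) (hb : b ∈ A) (x : Matrix m m ℂ) :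
    (b : Matrix m m ℂ) * avg A x = avg A x * b := by
  have h := conj_avg A b (fun a ha => A.mul_mem (A.mul_mem hb ha) (A.inv_mem hb)) x
  rw [avg_conj A b hb] at h
  calc (b : Matrix m m ℂ) * avg A x
      = ((b : Matrix m m ℂ) * avg A x * ((b⁻¹ : (Matrix m m ℂ)ˣ) : Matrix m m ℂ)) * b := by simp
    _ = _ := by rw [h]

theorem avg_of_comm (x : Matrix m m ℂ) (hx : ∀ a ∈ A, (a : Matrix m m ℂ) * x = x * a) :
    avg A x = (Fintype.card A : ℂ) • x := by
  rw [avg_apply]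
  have : ∀ a : A, ((a : (Matrix m m ℂ)ˣ) : Matrix m m ℂ) * x *
    (((a : (Matrix m m ℂ)ˣ)⁻¹ : (Matrix m m ℂ)ˣ) : Matrix m m ℂ) = x := by
    intro a
    rw [hx a a.2, mul_assoc]
    simp
  rw [Finset.sum_congr rfl (fun a _ => this a), Finset.sum_const, Finset.card_univ,
    Nat.cast_smul_eq_nsmul]

/-- If `S` spans and averaging kills everything in `S` not commuting with `A`, then the
part of `S` commuting with `A` spans the commutant of `A`. -/
theorem span_of_avg (S : Set (Matrix m m ℂ)) (hS : Submodule.span ℂ S = ⊤)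
    (h0 : ∀ s ∈ S, (∀ a ∈ A, s * (a : Matrix m m ℂ) = a * s) ∨ avg A s = 0)
    (x : Matrix m m ℂ) :
    x ∈ Submodule.span ℂ {s | s ∈ S ∧ ∀ a ∈ A, s * (a : Matrix m m ℂ) = a * s} ↔
      ∀ a ∈ A, x * (a : Matrix m m ℂ) = a * x := by
  constructor
  · intro hx a ha
    induction hx using Submodule.span_induction with
    | mem s hs => exact hs.2 a ha
    | zero => simp
    | add u v _ _ hu hv => rw [add_mul, mul_add, hu, hv]
    | smul c u _ hu => rw [smul_mul_assoc, mul_smul_comm, hu]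
  · intro hx
    have key : ∀ y : Matrix m m ℂ, avg A y ∈
        Submodule.span ℂ {s | s ∈ S ∧ ∀ a ∈ A, s * (a : Matrix m m ℂ) = a * s} := by
      intro y
      have hy : y ∈ Submodule.span ℂ S := by rw [hS]; trivial
      induction hy using Submodule.span_induction with
      | mem s hs =>
        rcases h0 s hs with h | h
        · rw [avg_of_comm A s (fun a ha => (h a ha).symm)]
          exact Submodule.smul_mem _ _ (Submodule.subset_span ⟨hs, h⟩)
        · rw [h]; exact Submodule.zero_mem _
      | zero => rw [map_zero]; exact Submodule.zero_mem _
      | add u v _ _ hu hv => rw [map_add]; exact Submodule.add_mem _ hu hv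
      | smul c u _ hu => rw [map_smul]; exact Submodule.smul_mem _ _ hu
    have h1 := key x
    rw [avg_of_comm A x (fun a ha => (hx a ha).symm)] at h1
    have hc : (Fintype.card A : ℂ) ≠ 0 := by
      exact_mod_cast Fintype.card_ne_zero
    have h2 := Submodule.smul_mem _ (Fintype.card A : ℂ)⁻¹ h1
    rwa [smul_smul, inv_mul_cancel₀ hc, one_smul] at h2

theorem avg_zero_of_anticomm (b : (Matrix m m ℂ)ˣ) (hb : b ∈ A) (x : Matrix m m ℂ)
    (hx : (b : Matrix m m ℂ) * x = -(x * b)) : avg A x = 0 := by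
  have h := avg_conj A b hb x
  rw [hx] at h
  have h2 : -(x * (b : Matrix m m ℂ)) * ((b⁻¹ : (Matrix m m ℂ)ˣ) : Matrix m m ℂ) = -x := by
    simp [mul_assoc]
  rw [h2, map_neg] at h
  exact mat_eq_zero_of_eq_neg _ h.symm

/-- The key vanishing statement. -/
theorem avg_zero_of_irreducible (Γ : Subgroup (Matrix m m ℂ)ˣ)
    (hspan : Submodule.span ℂ ((fun u : (Matrix m m ℂ)ˣ => (u : Matrix m m ℂ)) '' Γ) = ⊤)
    (huni : ∀ g ∈ Γ, ((g⁻¹ : (Matrix m m ℂ)ˣ) : Matrix m m ℂ) = (g : Matrix m m ℂ)ᴴ)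
    (hsign : ∀ g ∈ Γ, ∀ k ∈ Γ, (g : Matrix m m ℂ) * k = k * g ∨ (g : Matrix m m ℂ) * k = -(k * g))
    (hinv : ∀ g ∈ Γ, ∀ a ∈ A, g * a * g⁻¹ ∈ A)
    (hAcomm : ∀ a ∈ A, ∀ b ∈ A, a * b = b * a)
    (g : (Matrix m m ℂ)ˣ) (hg : g ∈ Γ) :
    (∀ a ∈ A, (g : Matrix m m ℂ) * (a : Matrix m m ℂ) = a * g) ∨ avg A (g : Matrix m m ℂ) = 0 := by
  set x := avg A (g : Matrix m m ℂ) with hxdef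
  have hkx : ∀ k ∈ Γ, (k : Matrix m m ℂ) * x = x * k ∨ (k : Matrix m m ℂ) * x = -(x * k) := by
    intro k hk
    have h1 := conj_avg A k (hinv k hk) (g : Matrix m m ℂ)
    have h3 : (k : Matrix m m ℂ) * x =
        (k * x * ((k⁻¹ : (Matrix m m ℂ)ˣ) : Matrix m m ℂ)) * k := by simp
    rcases hsign k hk g hg with h | h
    · left
      have h2 : (k : Matrix m m ℂ) * g * ((k⁻¹ : (Matrix m m ℂ)ˣ) : Matrix m m ℂ) = g := by
        rw [h]; simp
      rw [h2] at h1
      rw [h3, h1]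
    · right
      have h2 : (k : Matrix m m ℂ) * g * ((k⁻¹ : (Matrix m m ℂ)ˣ) : Matrix m m ℂ) = -g := by
        rw [h]; simp
      rw [h2, map_neg] at h1
      rw [h3, h1, neg_mul]
  have hkxs : ∀ k ∈ Γ, (k : Matrix m m ℂ) * (xᴴ * x) = (xᴴ * x) * k := by
    intro k hk
    have hk' := huni k hk
    have hkk : (k : Matrix m m ℂ) * (k : Matrix m m ℂ)ᴴ = 1 := by rw [← hk']; simp
    have hkk2 : (k : Matrix m m ℂ)ᴴ * (k : Matrix m m ℂ) = 1 := by rw [← hk']; simp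
    have aux : ∀ y : Matrix m m ℂ, (k : Matrix m m ℂ) * y = k * y * (k : Matrix m m ℂ)ᴴ * k := by
      intro y; rw [mul_assoc, hkk2, mul_one]
    have h4 : (k : Matrix m m ℂ) * (xᴴ * x) * (k : Matrix m m ℂ)ᴴ = xᴴ * x := by
      have h5 : (k : Matrix m m ℂ) * (xᴴ * x) * (k : Matrix m m ℂ)ᴴ =
          ((k : Matrix m m ℂ) * x * (k : Matrix m m ℂ)ᴴ)ᴴ *
            ((k : Matrix m m ℂ) * x * (k : Matrix m m ℂ)ᴴ) := by
        simp only [conjTranspose_mul, conjTranspose_conjTranspose, mul_assoc]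
        rw [← mul_assoc (k : Matrix m m ℂ)ᴴ (k : Matrix m m ℂ), hkk2, one_mul]
      rw [h5]
      rcases hkx k hk with h | h
      · rw [h, mul_assoc, hkk, mul_one]
      · rw [h, neg_mul, mul_assoc, hkk, mul_one]; simp
    rw [aux, h4]
  have hcen : ∀ y : Matrix m m ℂ, y * (xᴴ * x) = (xᴴ * x) * y := by
    intro y
    have hy : y ∈ Submodule.span ℂ
      ((fun u : (Matrix m m ℂ)ˣ => (u : Matrix m m ℂ)) '' Γ) := by rw [hspan]; trivial
    induction hy using Submodule.span_induction with
    | mem s hs => obtain ⟨k, hk, rfl⟩ := hs; exact hkxs k hk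
    | zero => simp
    | add u v _ _ hu hv => rw [add_mul, mul_add, hu, hv]
    | smul c u _ hu => rw [smul_mul_assoc, mul_smul_comm, hu]
  obtain ⟨c, hc⟩ : ∃ c : ℂ, xᴴ * x = scalar m c := by
    have hmem : xᴴ * x ∈ Set.center (Matrix m m ℂ) := by
      rw [Semigroup.mem_center_iff]
      exact hcen
    rw [Matrix.center_eq_range] at hmem
    obtain ⟨c, hc⟩ := hmem
    exact ⟨c, hc.symm⟩
  by_cases hc0 : c = 0
  · right
    rw [hc0, map_zero] at hc
    exact Matrix.conjTranspose_mul_self_eq_zero.1 hc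
  · left
    intro a ha
    have hxa : ∀ b ∈ A, (b : Matrix m m ℂ) * x = x * b := fun b hb => avg_comm A b hb _
    have ha' := hinv g hg a ha
    have e1 : x * (a : Matrix m m ℂ) = ((g * a * g⁻¹ : (Matrix m m ℂ)ˣ) : Matrix m m ℂ) * x := by
      rw [hxdef, avg_apply, Finset.sum_mul, Finset.mul_sum]
      refine Finset.sum_congr rfl ?_
      intro b _
      have c1 : ((b : (Matrix m m ℂ)ˣ)⁻¹) * a = a * (b : (Matrix m m ℂ)ˣ)⁻¹ :=
        hAcomm _ (A.inv_mem b.2) a ha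
      have c2 : (b : (Matrix m m ℂ)ˣ) * (g * a * g⁻¹) = (g * a * g⁻¹) * b :=
        hAcomm _ b.2 _ ha'
      have : (b : (Matrix m m ℂ)ˣ) * g * (b : (Matrix m m ℂ)ˣ)⁻¹ * a =
          (g * a * g⁻¹) * (b * g * (b : (Matrix m m ℂ)ˣ)⁻¹) := by
        rw [mul_assoc (_ * _), c1, ← mul_assoc (g * a * g⁻¹), ← mul_assoc (g * a * g⁻¹), ← c2]
        group
      have h := congrArg (fun u : (Matrix m m ℂ)ˣ => (u : Matrix m m ℂ)) this
      simpa only [Units.val_mul] using h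
    rw [hxa _ ha'] at e1
    have e2 : c • (a : Matrix m m ℂ) = c • ((g * a * g⁻¹ : (Matrix m m ℂ)ˣ) : Matrix m m ℂ) := by
      have h := congrArg (fun y => xᴴ * y) e1
      simp only [← mul_assoc] at h
      rw [hc] at h
      simpa [Matrix.smul_eq_diagonal_mul] using h
    have e3 := smul_right_injective _ hc0 e2
    have e4 : a = g * a * g⁻¹ := Units.ext e3
    have e5 : g * a = a * g := by
      conv_rhs => rw [e4]
      simp
    exact congrArg (fun u : (Matrix m m ℂ)ˣ => (u : Matrix m m ℂ)) e5

end Averaging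

/-! ### Pauli operators -/

section Pauli

variable {n : ℕ}

/-- The sign character. -/
noncomputable def sgn2 (z : ZMod 2) : ℂ := (-1 : ℂ) ^ z.val

theorem sgn2_add (a b : ZMod 2) : sgn2 (a + b) = sgn2 a * sgn2 b := by
  have h11 : (1 : ZMod 2) + 1 = 0 := by decide
  have h01 : ∀ t : ZMod 2, t = 0 ∨ t = 1 := by decide
  rcases h01 a with rfl | rfl <;> rcases h01 b with rfl | rfl <;>
    simp [sgn2, ZMod.val_one, h11]

theorem sgn2_zero : sgn2 0 = 1 := by simp [sgn2]

theorem sgn2_one : sgn2 1 = -1 := by simp [sgn2, ZMod.val_one]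

theorem sgn2_cases (a : ZMod 2) : sgn2 a = 1 ∨ sgn2 a = -1 := by
  fin_cases a
  · left; exact sgn2_zero
  · right; exact sgn2_one

theorem zmod2_vec_add_self {ι : Type*} (a : ι → ZMod 2) : a + a = 0 := by
  funext i
  exact CharTwo.add_self_eq_zero (a i)

theorem tau_apply (a : Fin n ⊕ Fin n → ZMod 2) (y x : Fin n → ZMod 2) :
    tau n a y x = if y = x + (fun i => a (Sum.inr i)) then
      sgn2 ((fun i => a (Sum.inl i)) ⬝ᵥ (x + fun i => a (Sum.inr i))) else 0 := rfl

theorem tau_mul (a b : Fin n ⊕ Fin n → ZMod 2) :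
    tau n a * tau n b =
      sgn2 ((fun i => b (Sum.inl i)) ⬝ᵥ (fun i => a (Sum.inr i))) • tau n (a + b) := by
  ext y x
  rw [Matrix.mul_apply, Finset.sum_eq_single (x + fun i => b (Sum.inr i))]
  · rw [Matrix.smul_apply, tau_apply, tau_apply, tau_apply, if_pos rfl]
    have hw : (fun i => (a + b) (Sum.inr i)) =
      (fun i => b (Sum.inr i)) + (fun i => a (Sum.inr i)) := by
        funext i; simp [add_comm]
    have hv : (fun i => (a + b) (Sum.inl i)) =
      (fun i => a (Sum.inl i)) + (fun i => b (Sum.inl i)) := by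
        funext i; simp
    rw [hw, hv, ← add_assoc x]
    split_ifs with h
    · rw [smul_eq_mul, ← sgn2_add, ← sgn2_add]
      congr 1
      simp only [dotProduct_add, add_dotProduct]
      have : ∀ t : ZMod 2, t + t = 0 := fun t => CharTwo.add_self_eq_zero t
      generalize (fun i => b (Sum.inl i)) ⬝ᵥ (fun i => a (Sum.inr i)) = t
      have ht := this t
      linear_combination -ht
    · simp
  · intro z _ hz
    rw [tau_apply b, if_neg hz, mul_zero]
  · simp

theorem tau_zero : tau n 0 = 1 := by
  ext y x
  rw [tau_apply, Matrix.one_apply]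
  have : (fun i : Fin n => (0 : Fin n ⊕ Fin n → ZMod 2) (Sum.inr i)) = 0 := rfl
  have h2 : (fun i : Fin n => (0 : Fin n ⊕ Fin n → ZMod 2) (Sum.inl i)) = 0 := rfl
  rw [this, h2]
  simp [sgn2_zero]

theorem tau_anticomm (a : Fin n ⊕ Fin n → ZMod 2) (ha : a ≠ 0) :
    ∃ b, tau n a * tau n b = -(tau n b * tau n a) := by
  classical
  obtain ⟨j, hj⟩ := Function.ne_iff.1 ha
  have h01 : ∀ t : ZMod 2, t ≠ 0 → t = 1 := by decide
  have hj1 := h01 _ hj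
  rcases j with i | i
  · refine ⟨Pi.single (Sum.inr i) 1, ?_⟩
    rw [tau_mul, tau_mul, add_comm (Pi.single _ _) a]
    have e1 : (fun k : Fin n => (Pi.single (Sum.inr i) (1 : ZMod 2) : Fin n ⊕ Fin n → ZMod 2)
      (Sum.inl k)) = 0 := by funext k; simp
    have e2 : (fun k : Fin n => (Pi.single (Sum.inr i) (1 : ZMod 2) : Fin n ⊕ Fin n → ZMod 2)
      (Sum.inr k)) = Pi.single i 1 := by funext k; simp [Pi.single_apply]
    rw [e1, e2, zero_dotProduct, dotProduct_single_one, hj1, sgn2_zero, sgn2_one]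
    simp
  · refine ⟨Pi.single (Sum.inl i) 1, ?_⟩
    rw [tau_mul, tau_mul, add_comm (Pi.single _ _) a]
    have e1 : (fun k : Fin n => (Pi.single (Sum.inl i) (1 : ZMod 2) : Fin n ⊕ Fin n → ZMod 2)
      (Sum.inr k)) = 0 := by funext k; simp
    have e2 : (fun k : Fin n => (Pi.single (Sum.inl i) (1 : ZMod 2) : Fin n ⊕ Fin n → ZMod 2)
      (Sum.inl k)) = Pi.single i 1 := by funext k; simp [Pi.single_apply]
    rw [e1, e2, dotProduct_zero, single_one_dotProduct, hj1, sgn2_zero, sgn2_one]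
    simp

theorem phase_iff (c : ℂ) : (∃ δ ε : ZMod 2, c = Complex.I ^ δ.val * (-1 : ℂ) ^ ε.val) ↔
    c ^ 4 = 1 := by
  constructor
  · rintro ⟨δ, ε, rfl⟩
    rw [mul_pow, ← pow_mul, ← pow_mul, mul_comm _ 4, mul_comm _ 4, pow_mul, pow_mul,
      Complex.I_pow_four]
    norm_num
  · intro h
    have h1 : (c - 1) * (c + 1) * ((c - Complex.I) * (c + Complex.I)) = 0 := by
      linear_combination h - (c ^ 2 - 1) * Complex.I_sq
    rcases mul_eq_zero.1 h1 with h | h <;> rcases mul_eq_zero.1 h with h | h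
    · exact ⟨0, 0, by simpa using sub_eq_zero.1 h⟩
    · exact ⟨0, 1, by simpa [ZMod.val_one] using eq_neg_of_add_eq_zero_left h⟩
    · exact ⟨1, 0, by simpa [ZMod.val_one] using sub_eq_zero.1 h⟩
    · exact ⟨1, 1, by simpa [ZMod.val_one] using eq_neg_of_add_eq_zero_left h⟩

theorem mem_pauli (M : Matrix (Fin n → ZMod 2) (Fin n → ZMod 2) ℂ) :
    M ∈ PauliGroup n ↔ ∃ (c : ℂ) (a : Fin n ⊕ Fin n → ZMod 2), c ^ 4 = 1 ∧ M = c • tau n a := by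
  constructor
  · rintro ⟨δ, ε, a, rfl⟩
    exact ⟨_, a, (phase_iff _).1 ⟨δ, ε, rfl⟩, rfl⟩
  · rintro ⟨c, a, hc, rfl⟩
    obtain ⟨δ, ε, h⟩ := (phase_iff c).2 hc
    exact ⟨δ, ε, a, by rw [h]⟩

theorem tau_mem (a : Fin n ⊕ Fin n → ZMod 2) : tau n a ∈ PauliGroup n :=
  (mem_pauli _).2 ⟨1, a, by simp, by simp⟩

theorem pauli_one : (1 : Matrix (Fin n → ZMod 2) (Fin n → ZMod 2) ℂ) ∈ PauliGroup n := by
  rw [← tau_zero]; exact tau_mem 0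

theorem pauli_neg (M : Matrix (Fin n → ZMod 2) (Fin n → ZMod 2) ℂ) (h : M ∈ PauliGroup n) :
    -M ∈ PauliGroup n := by
  rw [mem_pauli] at *
  obtain ⟨c, a, hc, rfl⟩ := h
  exact ⟨-c, a, by rw [← hc]; ring, by simp⟩

theorem sgn2_pow_four (z : ZMod 2) : sgn2 z ^ 4 = 1 := by
  rcases sgn2_cases z with h | h <;> rw [h] <;> norm_num

theorem pauli_mul (M N : Matrix (Fin n → ZMod 2) (Fin n → ZMod 2) ℂ) (h : M ∈ PauliGroup n)
    (h' : N ∈ PauliGroup n) : M * N ∈ PauliGroup n := by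
  rw [mem_pauli] at *
  obtain ⟨c, a, hc, rfl⟩ := h
  obtain ⟨d, b, hd, rfl⟩ := h'
  refine ⟨c * d * sgn2 ((fun i => b (Sum.inl i)) ⬝ᵥ (fun i => a (Sum.inr i))), a + b, ?_, ?_⟩
  · rw [mul_pow, mul_pow, hc, hd, sgn2_pow_four]; norm_num
  · rw [smul_mul_smul_comm, tau_mul, smul_smul]

theorem tau_sq (a : Fin n ⊕ Fin n → ZMod 2) :
    tau n a * tau n a = 1 ∨ tau n a * tau n a = -1 := by
  rw [tau_mul, zmod2_vec_add_self, tau_zero]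
  rcases sgn2_cases ((fun i => a (Sum.inl i)) ⬝ᵥ (fun i => a (Sum.inr i))) with h | h <;>
    rw [h] <;> simp

theorem pauli_pow_four (M : Matrix (Fin n → ZMod 2) (Fin n → ZMod 2) ℂ)
    (h : M ∈ PauliGroup n) : M ^ 4 = 1 := by
  rw [mem_pauli] at *
  obtain ⟨c, a, hc, rfl⟩ := h
  rw [smul_pow, hc, one_smul, show 4 = 2 * 2 from rfl, pow_mul, pow_two (tau n a)]
  rcases tau_sq a with h | h <;> rw [h] <;> simp

theorem pauli_pow (M : Matrix (Fin n → ZMod 2) (Fin n → ZMod 2) ℂ)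
    (h : M ∈ PauliGroup n) (k : ℕ) : M ^ k ∈ PauliGroup n := by
  induction k with
  | zero => rw [pow_zero]; exact pauli_one
  | succ k ih => rw [pow_succ]; exact pauli_mul _ _ ih h

theorem pauli_sign (M N : Matrix (Fin n → ZMod 2) (Fin n → ZMod 2) ℂ) (h : M ∈ PauliGroup n)
    (h' : N ∈ PauliGroup n) : M * N = N * M ∨ M * N = -(N * M) := by
  rw [mem_pauli] at *
  obtain ⟨c, a, hc, rfl⟩ := h
  obtain ⟨d, b, hd, rfl⟩ := h'
  rw [smul_mul_smul_comm, smul_mul_smul_comm, tau_mul, tau_mul, mul_comm d c, add_comm b a]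
  rcases sgn2_cases ((fun i => b (Sum.inl i)) ⬝ᵥ (fun i => a (Sum.inr i))) with h | h <;>
  rcases sgn2_cases ((fun i => a (Sum.inl i)) ⬝ᵥ (fun i => b (Sum.inr i))) with h2 | h2 <;>
    rw [h, h2] <;> simp

theorem pauli_isSubgroup : IsSubgroupOfSet (PauliGroup n) (PauliGroup n) := by
  refine ⟨le_rfl, pauli_one, fun a ha b hb => pauli_mul a b ha hb, fun a ha => ?_⟩
  refine ⟨a ^ 3, pauli_pow a ha 3, ?_, ?_⟩
  · rw [← pow_succ', pauli_pow_four a ha]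
  · rw [← pow_succ, pauli_pow_four a ha]

theorem pauli_finite : (PauliGroup n).Finite := by
  have : PauliGroup n ⊆ Set.range
      (fun t : ZMod 2 × ZMod 2 × (Fin n ⊕ Fin n → ZMod 2) =>
        (Complex.I ^ t.1.val * (-1 : ℂ) ^ t.2.1.val) • tau n t.2.2) := by
    rintro M ⟨δ, ε, a, rfl⟩
    exact ⟨(δ, ε, a), rfl⟩
  exact (Set.finite_range _).subset this

theorem neg_one_ne_one_mat :
    (-1 : Matrix (Fin n → ZMod 2) (Fin n → ZMod 2) ℂ) ≠ 1 := by
  intro h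
  have := congrFun (congrFun h 0) 0
  simp only [Matrix.neg_apply, Matrix.one_apply_eq] at this
  norm_num at this

/-- Representations of the Pauli group: spanning. -/
theorem rep_span
    (φ : Matrix (Fin n → ZMod 2) (Fin n → ZMod 2) ℂ →
         Matrix (Fin n → ZMod 2) (Fin n → ZMod 2) ℂ)
    (hφmul : ∀ a ∈ PauliGroup n, ∀ b ∈ PauliGroup n, φ (a * b) = φ a * φ b)
    (h1 : φ 1 = 1) (htr : (1 - φ (-1)).trace ≠ 0) :
    Submodule.span ℂ (Set.range fun a => (1 - φ (-1)) * φ (tau n a)) = ⊤ := by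
  have hm1 : (-1 : Matrix (Fin n → ZMod 2) (Fin n → ZMod 2) ℂ) ∈ PauliGroup n :=
    pauli_neg _ pauli_one
  set z := φ (-1) with hz
  have hzz : z * z = 1 := by rw [hz, ← hφmul _ hm1 _ hm1]; simpa using h1
  have hneg : ∀ σ ∈ PauliGroup n, φ (-σ) = z * φ σ := by
    intro σ hσ
    rw [hz, ← hφmul _ hm1 _ hσ]; simp
  have hneg' : ∀ σ ∈ PauliGroup n, φ (-σ) = φ σ * z := by
    intro σ hσ
    rw [hz, ← hφmul _ hσ _ hm1]; simp
  have hQz : (1 - z) * z = -(1 - z) := by rw [sub_mul, hzz, one_mul]; abel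
  have trace0 : ∀ σ ∈ PauliGroup n, ∀ ρ ∈ PauliGroup n, σ * ρ = -(ρ * σ) →
      ((1 - z) * φ σ).trace = 0 := by
    intro σ hσ ρ hρ h
    obtain ⟨ρ', hρ', hr, -⟩ := pauli_isSubgroup.2.2.2 ρ hρ
    have e1 : φ ρ * φ ρ' = 1 := by rw [← hφmul _ hρ _ hρ', hr, h1]
    have e1' : φ ρ' * φ ρ = 1 := mul_eq_one_comm.1 e1
    have e2 : φ σ * φ ρ = z * (φ ρ * φ σ) := by
      rw [← hφmul _ hσ _ hρ, h, hneg _ (pauli_mul _ _ hρ hσ), hφmul _ hρ _ hσ]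
    have e3 : (1 - z) * φ ρ = φ ρ * (1 - z) := by
      rw [sub_mul, mul_sub, ← hneg _ hρ, hneg' _ hρ, one_mul, mul_one]
    have e4 : (1 - z) * φ σ * φ ρ = -(φ ρ * ((1 - z) * φ σ)) := by
      rw [mul_assoc, e2, ← mul_assoc, hQz, neg_mul, ← mul_assoc, ← mul_assoc, e3]
    have e5 : (1 - z) * φ σ = -(φ ρ * ((1 - z) * φ σ)) * φ ρ' := by
      rw [← e4, mul_assoc, e1, mul_one]
    have e6 := congrArg Matrix.trace e5
    rw [neg_mul, Matrix.trace_neg, Matrix.trace_mul_comm (φ ρ * _), ← mul_assoc, e1', one_mul] at e6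
    exact self_eq_neg.1 e6
  have hli : LinearIndependent ℂ (fun a => (1 - z) * φ (tau n a)) := by
    rw [Fintype.linearIndependent_iff]
    intro c hc b
    have h2 := congrArg (fun M => (M * φ (tau n b)).trace) hc
    simp only [Finset.sum_mul, Matrix.trace_sum, zero_mul, Matrix.trace_zero] at h2
    rw [Finset.sum_eq_single b] at h2
    · rw [smul_mul_assoc, Matrix.trace_smul, mul_assoc, ← hφmul _ (tau_mem b) _ (tau_mem b),
        smul_eq_mul] at h2
      refine (mul_eq_zero.1 h2).resolve_right ?_
      rcases tau_sq b with h | h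
      · rw [h, h1, mul_one]; exact htr
      · rw [h, ← hz, hQz, Matrix.trace_neg]; exact neg_ne_zero.2 htr
    · intro a _ hab
      have hne : a + b ≠ 0 := by
        intro h
        apply hab
        have h3 := congrArg (fun t => t + b) h
        simpa [add_assoc, zmod2_vec_add_self] using h3
      obtain ⟨d, hd⟩ := tau_anticomm _ hne
      rw [smul_mul_assoc, Matrix.trace_smul, mul_assoc, ← hφmul _ (tau_mem a) _ (tau_mem b),
        trace0 _ (pauli_mul _ _ (tau_mem a) (tau_mem b)) _ (tau_mem d) ?_, smul_zero]
      rw [tau_mul, smul_mul_assoc, mul_smul_comm, hd, smul_neg]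
    · simp
  refine hli.span_eq_top_of_card_eq_finrank' ?_
  rw [Module.finrank_matrix, Module.finrank_self]
  simp [pow_add, Fintype.card_sum]

end Pauli

/-- The group of units with value in a set which is a group of matrices. -/
def unitsOf {M : Type*} [Monoid M] (S : Set M) (h : IsSubgroupOfSet S S) : Subgroup Mˣ where
  carrier := {u | (u : M) ∈ S}
  one_mem' := by simpa using h.2.1
  mul_mem' := by
    intro a b ha hb
    simpa using h.2.2.1 _ ha _ hb
  inv_mem' := by
    intro a ha
    obtain ⟨b, hb, hab, -⟩ := h.2.2.2 _ ha
    change ((a⁻¹ : Mˣ) : M) ∈ S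
    rwa [Units.inv_eq_of_mul_eq_one_right hab]

theorem mem_unitsOf {M : Type*} [Monoid M] (S : Set M) (h : IsSubgroupOfSet S S) (u : Mˣ) :
    u ∈ unitsOf S h ↔ (u : M) ∈ S := Iff.rfl

theorem exists_unit {M : Type*} [Monoid M] (S : Set M) (h : IsSubgroupOfSet S S) (s : M)
    (hs : s ∈ S) : ∃ u ∈ unitsOf S h, (u : M) = s := by
  obtain ⟨b, hb, hab, hba⟩ := h.2.2.2 _ hs
  exact ⟨⟨s, b, hab, hba⟩, hs, rfl⟩

theorem image_unitsOf {M : Type*} [Monoid M] (S : Set M) (h : IsSubgroupOfSet S S) :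
    (fun u : Mˣ => (u : M)) '' (unitsOf S h) = S := by
  ext s
  constructor
  · rintro ⟨u, hu, rfl⟩; exact hu
  · intro hs
    obtain ⟨u, hu, rfl⟩ := exists_unit S h s hs
    exact ⟨u, hu, rfl⟩

/-- The centralizer of `A` in `S` is a subgroup. -/
theorem centralizer_isSubgroup {M : Type*} [Monoid M] (S : Set M) (h : IsSubgroupOfSet S S)
    (A : Subgroup Mˣ) :
    IsSubgroupOfSet {s | s ∈ S ∧ ∀ a ∈ A, s * (a : M) = a * s} S := by
  refine ⟨fun s hs => hs.1, ⟨h.2.1, by simp⟩, ?_, ?_⟩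
  · rintro s ⟨hs, hs'⟩ t ⟨ht, ht'⟩
    refine ⟨h.2.2.1 _ hs _ ht, fun a ha => ?_⟩
    rw [mul_assoc, ht' a ha, ← mul_assoc, hs' a ha, mul_assoc]
  · rintro s ⟨hs, hs'⟩
    obtain ⟨b, hb, hsb, hbs⟩ := h.2.2.2 _ hs
    refine ⟨b, ⟨hb, fun a ha => ?_⟩, hsb, hbs⟩
    calc b * (a : M) = b * (a * (s * b)) := by rw [hsb, mul_one]
      _ = b * (s * a) * b := by rw [hs' a ha]; simp only [mul_assoc]
      _ = a * b := by rw [← mul_assoc b, hbs, one_mul]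

theorem comm_span {m : Type*} [Fintype m] [DecidableEq m] (S : Set (Matrix m m ℂ))
    (k : Matrix m m ℂ) (hk : ∀ s ∈ S, k * s = s * k) (x : Matrix m m ℂ)
    (hx : x ∈ Submodule.span ℂ S) : k * x = x * k := by
  induction hx using Submodule.span_induction with
  | mem s hs => exact hk s hs
  | zero => simp
  | add u v _ _ hu hv => rw [add_mul, mul_add, hu, hv]
  | smul c u _ hu => rw [smul_mul_assoc, mul_smul_comm, hu]

theorem centralizer_isMax {m : Type*} [Fintype m] [DecidableEq m] (S : Set (Matrix m m ℂ))
    (h : IsSubgroupOfSet S S) (A : Subgroup (Matrix m m ℂ)ˣ)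
    (hA : ∀ a ∈ A, ∀ b ∈ A, a * b = b * a)
    (hspan : ∀ x, x ∈ Submodule.span ℂ
      {s | s ∈ S ∧ ∀ a ∈ A, s * (a : Matrix m m ℂ) = a * s} ↔
      ∀ a ∈ A, x * (a : Matrix m m ℂ) = a * x)
    (hcomm : ∀ x y : Matrix m m ℂ, (∀ a ∈ A, x * (a : Matrix m m ℂ) = a * x) →
      (∀ a ∈ A, y * (a : Matrix m m ℂ) = a * y) → x * y = y * x) :
    IsMaxAbelianSubgroup {s | s ∈ S ∧ ∀ a ∈ A, s * (a : Matrix m m ℂ) = a * s} S := by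
  refine ⟨centralizer_isSubgroup S h A, fun x hx y hy => hcomm x y hx.2 hy.2, ?_⟩
  intro K hK hKc hsub
  refine Set.Subset.antisymm ?_ hsub
  intro k hk
  refine ⟨hK.1 hk, fun a ha => ?_⟩
  refine comm_span _ k (fun s hs => hKc k hk s (hsub hs)) _ ((hspan _).2 ?_)
  intro b hb
  have := hA a ha b hb
  exact congrArg (fun u : (Matrix m m ℂ)ˣ => (u : Matrix m m ℂ)) this

/-- If `G` is a subgroup of the Clifford group which is isomorphic, as an abstract
group, to the Pauli group (witnessed by a multiplicative bijection `φ` from the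
Pauli group onto `G`), then there exist a maximal abelian subgroup `H` of `G` and a
maximal abelian subgroup `H'` of the Pauli group with `span_ℂ(H) = span_ℂ(H')`. -/
theorem subgroup_iso_pauli_span (n : ℕ) (hn : 1 ≤ n)
    (G : Set (Matrix (Fin n → ZMod 2) (Fin n → ZMod 2) ℂ))
    (hG : IsSubgroupOfSet G (Clifford2 n))
    (φ : Matrix (Fin n → ZMod 2) (Fin n → ZMod 2) ℂ →
         Matrix (Fin n → ZMod 2) (Fin n → ZMod 2) ℂ)
    (hφbij : Set.BijOn φ (PauliGroup n) G)
    (hφmul : ∀ a ∈ PauliGroup n, ∀ b ∈ PauliGroup n, φ (a * b) = φ a * φ b) :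
    ∃ H H' : Set (Matrix (Fin n → ZMod 2) (Fin n → ZMod 2) ℂ),
      IsMaxAbelianSubgroup H G ∧
      IsMaxAbelianSubgroup H' (PauliGroup n) ∧
      Submodule.span ℂ H = Submodule.span ℂ H' := by
  classical
  have hGG : IsSubgroupOfSet G G := ⟨le_rfl, hG.2⟩
  have hm1 : (-1 : Matrix (Fin n → ZMod 2) (Fin n → ZMod 2) ℂ) ∈ PauliGroup n :=
    pauli_neg _ pauli_one
  have hφG : ∀ σ ∈ PauliGroup n, φ σ ∈ G := fun σ hσ => hφbij.mapsTo hσ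
  have h1 : φ 1 = 1 := by
    obtain ⟨b, -, hb, -⟩ := hGG.2.2.2 _ (hφG 1 pauli_one)
    have h := hφmul 1 pauli_one 1 pauli_one
    rw [mul_one] at h
    calc φ 1 = φ 1 * (φ 1 * b) := by rw [hb, mul_one]
      _ = 1 := by rw [← mul_assoc, ← h, hb]
  -- the image of `-1` is `-1`
  have hzz : φ (-1) * φ (-1) = 1 := by rw [← hφmul _ hm1 _ hm1]; simpa using h1
  have hzne : φ (-1) ≠ 1 := by
    intro h
    exact neg_one_ne_one_mat (hφbij.injOn hm1 pauli_one (h.trans h1.symm))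
  have hzH : (φ (-1))ᴴ = φ (-1) := by
    have hu := (hG.1 (hφG _ hm1)).1.1
    calc (φ (-1))ᴴ = φ (-1) * φ (-1) * (φ (-1))ᴴ := by rw [hzz, one_mul]
      _ = φ (-1) := by rw [mul_assoc, hu, mul_one]
  have htr : (1 - φ (-1)).trace ≠ 0 := by
    intro h
    have hQ : (1 - φ (-1))ᴴ * (1 - φ (-1)) = (2 : ℂ) • (1 - φ (-1)) := by
      rw [conjTranspose_sub, conjTranspose_one, hzH, sub_mul, mul_sub, mul_sub, hzz, two_smul]
      simp only [one_mul, mul_one]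
      abel
    have h2 : ((1 - φ (-1))ᴴ * (1 - φ (-1))).trace = 0 := by
      rw [hQ, trace_smul, h, smul_zero]
    have h3 : 1 - φ (-1) = 0 := by
      open scoped ComplexOrder in
      exact Matrix.trace_conjTranspose_mul_self_eq_zero_iff.1 h2
    exact hzne (sub_eq_zero.1 h3).symm
  have hrep := rep_span φ hφmul h1 htr
  have hz : φ (-1) = -1 := by
    obtain ⟨M, hM⟩ : ∃ M, (1 - φ (-1)) * M = 1 := by
      have hle : Submodule.span ℂ (Set.range fun a => (1 - φ (-1)) * φ (tau n a)) ≤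
          LinearMap.range (LinearMap.mulLeft ℂ (1 - φ (-1))) := by
        refine Submodule.span_le.2 ?_
        rintro _ ⟨a, rfl⟩
        exact ⟨φ (tau n a), rfl⟩
      rw [hrep] at hle
      exact hle (Submodule.mem_top (x := 1))
    have hQ : φ (-1) * (1 - φ (-1)) = -(1 - φ (-1)) := by rw [mul_sub, hzz, mul_one]; abel
    calc φ (-1) = φ (-1) * (1 - φ (-1)) * M := by rw [mul_assoc, hM, mul_one]
      _ = -1 := by rw [hQ, neg_mul, hM]
  have hφneg : ∀ σ ∈ PauliGroup n, φ (-σ) = -φ σ := by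
    intro σ hσ
    have h := hφmul _ hm1 _ hσ
    rw [hz] at h
    simpa using h
  have hspanG : Submodule.span ℂ G = ⊤ := by
    rw [eq_top_iff, ← hrep]
    refine Submodule.span_le.2 ?_
    rintro _ ⟨a, rfl⟩
    have : (1 - φ (-1)) * φ (tau n a) = φ (tau n a) + φ (tau n a) := by
      rw [hz, sub_neg_eq_add, add_mul, one_mul]
    simp only [this, SetLike.mem_coe]
    have hmem := Submodule.subset_span (R := ℂ) (hφG _ (tau_mem a))
    exact Submodule.add_mem _ hmem hmem
  have hspanP : Submodule.span ℂ (PauliGroup n) = ⊤ := by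
    have htr1 : (1 - (-1) : Matrix (Fin n → ZMod 2) (Fin n → ZMod 2) ℂ).trace ≠ 0 := by
      rw [sub_neg_eq_add, trace_add, trace_one, ← two_mul]
      simp
    have h := rep_span (n := n) (fun x => x) (fun _ _ _ _ => rfl) rfl htr1
    rw [eq_top_iff, ← h]
    refine Submodule.span_le.2 ?_
    rintro _ ⟨a, rfl⟩
    have : (1 - (-1)) * (tau n a) = tau n a + tau n a := by
      rw [sub_neg_eq_add, add_mul, one_mul]
    simp only [this, SetLike.mem_coe]
    have hmem := Submodule.subset_span (R := ℂ) (tau_mem a)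
    exact Submodule.add_mem _ hmem hmem
  have hsignG : ∀ g ∈ G, ∀ k ∈ G, g * k = k * g ∨ g * k = -(k * g) := by
    intro g hg k hk
    obtain ⟨σ, hσ, rfl⟩ := hφbij.surjOn hg
    obtain ⟨ρ, hρ, rfl⟩ := hφbij.surjOn hk
    rw [← hφmul _ hσ _ hρ, ← hφmul _ hρ _ hσ]
    rcases pauli_sign σ ρ hσ hρ with h | h
    · left; rw [h]
    · right; rw [h, hφneg _ (pauli_mul _ _ hρ hσ)]
  have hpow4G : ∀ g ∈ G, g ^ 4 = 1 := by
    intro g hg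
    obtain ⟨σ, hσ, rfl⟩ := hφbij.surjOn hg
    have hp : ∀ k : ℕ, φ σ ^ k = φ (σ ^ k) := by
      intro k
      induction k with
      | zero => rw [pow_zero, pow_zero, h1]
      | succ k ih => rw [pow_succ, pow_succ, ih, hφmul _ (pauli_pow σ hσ k) _ hσ]
    rw [hp, pauli_pow_four σ hσ, h1]
  -- groups of units
  set P := unitsOf (PauliGroup n) pauli_isSubgroup with hPdef
  set Γ := unitsOf G hGG with hΓdef
  have hPfin : Finite P := by
    have := (pauli_finite (n := n)).to_subtype
    refine Finite.of_injective (fun u : P => (⟨_, u.2⟩ : PauliGroup n)) ?_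
    intro u v huv
    exact Subtype.ext (Units.ext (congrArg Subtype.val huv))
  have hP2 : IsPGroup 2 P := by
    intro u
    refine ⟨2, Subtype.ext (Units.ext ?_)⟩
    simpa using pauli_pow_four _ u.2
  have hΓ2 : IsPGroup 2 Γ := by
    intro u
    refine ⟨2, Subtype.ext (Units.ext ?_)⟩
    simpa using hpow4G _ u.2
  have huni : ∀ g ∈ Γ, ((g⁻¹ : (Matrix (Fin n → ZMod 2) (Fin n → ZMod 2) ℂ)ˣ) :
      Matrix (Fin n → ZMod 2) (Fin n → ZMod 2) ℂ) =
      (g : Matrix (Fin n → ZMod 2) (Fin n → ZMod 2) ℂ)ᴴ := by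
    intro g hg
    exact Units.inv_eq_of_mul_eq_one_right (hG.1 hg).1.1
  have hnorm : ∀ g ∈ Γ, ∀ p ∈ P, g * p * g⁻¹ ∈ P := by
    intro g hg p hp
    have h := (hG.1 hg).2 _ hp
    rw [hPdef, mem_unitsOf, Units.val_mul, Units.val_mul, huni g hg]
    exact h
  obtain ⟨A, hAP, hAinv, hAcomm, hAself⟩ :=
    exists_invariant_selfcentralizing P Γ hP2 hΓ2 hnorm
  have hAfin : Finite A := Finite.of_injective (Subgroup.inclusion hAP)
    (Subgroup.inclusion_injective _)
  have : Fintype A := Fintype.ofFinite A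
  have hSP := span_of_avg A (PauliGroup n) hspanP (by
    intro s hs
    by_cases hc : ∀ a ∈ A, s * (a : Matrix (Fin n → ZMod 2) (Fin n → ZMod 2) ℂ) = a * s
    · exact Or.inl hc
    · right
      push Not at hc
      obtain ⟨a, ha, hne⟩ := hc
      refine avg_zero_of_anticomm A a ha s ?_
      exact (pauli_sign _ _ (hAP ha) hs).resolve_left (fun h => hne h.symm))
  have hSG := span_of_avg A G hspanG (by
    intro s hs
    obtain ⟨g, hg, rfl⟩ := exists_unit G hGG s hs
    refine avg_zero_of_irreducible A Γ ?_ huni (fun g hg k hk => hsignG _ hg _ hk)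
      hAinv hAcomm g hg
    rw [hΓdef, image_unitsOf, hspanG])
  have hcomm : ∀ x y : Matrix (Fin n → ZMod 2) (Fin n → ZMod 2) ℂ,
      (∀ a ∈ A, x * (a : Matrix (Fin n → ZMod 2) (Fin n → ZMod 2) ℂ) = a * x) →
      (∀ a ∈ A, y * (a : Matrix (Fin n → ZMod 2) (Fin n → ZMod 2) ℂ) = a * y) →
      x * y = y * x := by
    intro x y hx hy
    refine comm_span _ x ?_ y ((hSP y).2 hy)
    rintro s ⟨hs, hsA⟩
    obtain ⟨p, hp, rfl⟩ := exists_unit _ pauli_isSubgroup s hs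
    refine hx p (hAself p hp (fun a ha => Units.ext ?_))
    simpa using hsA a ha
  refine ⟨_, _, centralizer_isMax G hGG A hAcomm hSG hcomm,
    centralizer_isMax (PauliGroup n) pauli_isSubgroup A hAcomm hSP hcomm, ?_⟩
  ext x
  rw [hSG, hSP]
end

section
/- Let Q_1, …, Q_{2n} be unitary operators on H_n satisfying Q_i² = I for all i, and, for all i ≤ j, Q_i Q_j = (−1)^{δ_{i+n,j}} Q_j Q_i (i.e. Q_i and Q_j anticommute when j = i+n and commute otherwise). Then there exists a unitary U on H_n such that Q_i = U τ_{e_i} U† for every i = 1, …, 2n, where e_i denotes the i-th standard basis vector of Z_2^{2n}; explicitly, τ_{e_i}|x⟩ = (−1)^{x_i}|x⟩ for 1 ≤ i ≤ n, and τ_{e_{n+k}}|x⟩ = |x + e_k⟩ for 1 ≤ k ≤ n. -/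
open Matrix

/-- `e i` is the `i`-th standard basis vector of `Z_2^{2n}` (indexed by `Fin n ⊕ Fin n`;
`Sum.inl k` corresponds to index `k ∈ {1,…,n}` and `Sum.inr k` to index `n + k`). -/
def stdBasis (n : ℕ) (i : Fin n ⊕ Fin n) : Fin n ⊕ Fin n → ZMod 2 :=
  fun j => if j = i then 1 else 0

/-- `antiPair i j` holds exactly when `{i, j} = {k, n + k}` for some `k`, i.e. when
`τ_{e_i}` and `τ_{e_j}` anticommute (Kronecker delta `δ_{i+n,j}` for `i ≤ j`). -/
def antiPair {n : ℕ} : Fin n ⊕ Fin n → Fin n ⊕ Fin n → Prop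
  | Sum.inl k, Sum.inr k' => k = k'
  | Sum.inr k, Sum.inl k' => k = k'
  | _, _ => False

instance {n : ℕ} : DecidableRel (antiPair (n := n)) := by
  intro i j
  cases i <;> cases j <;> simp only [antiPair] <;> infer_instance

theorem zmod_two_cases (a : ZMod 2) : a = 0 ∨ a = 1 := by
  revert a; decide

theorem eps_add (a b : ZMod 2) : (-1 : ℂ) ^ (a + b).val = (-1) ^ a.val * (-1) ^ b.val := by
  have h2 : (1 : ZMod 2) + 1 = 0 := by decide
  rcases zmod_two_cases a with rfl | rfl <;> rcases zmod_two_cases b with rfl | rfl <;>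
    simp [ZMod.val_one, h2]

theorem sq_add {M : Type*} [Monoid M] (X : M) (h : X * X = 1) (a b : ZMod 2) :
    X ^ (a + b).val = X ^ a.val * X ^ b.val := by
  have h2 : (1 : ZMod 2) + 1 = 0 := by decide
  rcases zmod_two_cases a with rfl | rfl <;> rcases zmod_two_cases b with rfl | rfl <;>
    simp [ZMod.val_one, h2, h]

theorem eps_ne (a b : ZMod 2) (h : a ≠ b) : (-1 : ℂ) ^ a.val * (-1) ^ b.val = -1 := by
  rcases zmod_two_cases a with rfl | rfl <;> rcases zmod_two_cases b with rfl | rfl <;>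
    simp [ZMod.val_one] at h ⊢

section
variable {n : ℕ} {I : Type*} [Fintype I] [DecidableEq I]

/-- A common `+1` eigenvector. -/
theorem exists_stab (Z X : Fin n → Matrix I I ℂ) [Nonempty I]
    (hX2 : ∀ k, X k * X k = 1) (hZ2 : ∀ k, Z k * Z k = 1)
    (hZZ : ∀ j k, Z j * Z k = Z k * Z j)
    (hZX : ∀ j k, Z j * X k = (if j = k then (-1 : ℂ) else 1) • (X k * Z j))
    (S : Finset (Fin n)) : ∃ ψ : I → ℂ, ψ ≠ 0 ∧ ∀ k ∈ S, Z k *ᵥ ψ = ψ := by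
  induction S using Finset.induction_on with
  | empty => exact ⟨fun _ => 1, fun h => one_ne_zero (congrFun h (Classical.arbitrary I)), by simp⟩
  | insert k T hk ih =>
    obtain ⟨ψ, h0, hψ⟩ := ih
    by_cases h : Z k *ᵥ ψ + ψ = 0
    · have h' : Z k *ᵥ ψ = -ψ := eq_neg_of_add_eq_zero_left h
      refine ⟨X k *ᵥ ψ, ?_, ?_⟩
      · intro h1
        apply h0
        have := congrArg (fun v => X k *ᵥ v) h1
        simpa [mulVec_mulVec, hX2] using this
      · intro j hj
        rw [mulVec_mulVec, hZX, smul_mulVec, ← mulVec_mulVec]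
        rcases Finset.mem_insert.1 hj with rfl | hj'
        · simp [h', mulVec_neg]
        · have : j ≠ k := by rintro rfl; exact hk hj'
          simp [this, hψ j hj']
    · refine ⟨_, h, ?_⟩
      intro j hj
      rw [mulVec_add, mulVec_mulVec]
      rcases Finset.mem_insert.1 hj with rfl | hj'
      · simp [hZ2, add_comm]
      · rw [hZZ, ← mulVec_mulVec, hψ j hj']

theorem exists_hom (Z X : Fin n → Matrix I I ℂ)
    (hXu : ∀ k, (X k)ᴴ * X k = 1)
    (hX2 : ∀ k, X k * X k = 1) (hZ2 : ∀ k, Z k * Z k = 1)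
    (hXX : ∀ j k, X j * X k = X k * X j)
    (hZX : ∀ j k, Z j * X k = (if j = k then (-1 : ℂ) else 1) • (X k * Z j)) :
    ∃ F : (Fin n → ZMod 2) → Matrix I I ℂ,
      F 0 = 1 ∧ (∀ x, (F x)ᴴ * F x = 1) ∧ (∀ k x, X k * F x = F (x + Pi.single k 1)) ∧
      (∀ k x, Z k * F x = (-1 : ℂ) ^ (x k).val • (F x * Z k)) := by
  let f : ∀ _ : Fin n, Multiplicative (ZMod 2) →* Matrix I I ℂ := fun k =>
    { toFun := fun a => X k ^ (a.toAdd).val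
      map_one' := by simp
      map_mul' := fun a b => sq_add _ (hX2 k) _ _ }
  have hc : Pairwise fun i j => ∀ x y, Commute (f i x) (f j y) := by
    intro i j _ x y
    exact Commute.pow_pow (hXX i j) _ _
  let F := MonoidHom.noncommPiCoprod f hc
  have hF : ∀ k a, F (Pi.mulSingle k a) = X k ^ (a.toAdd).val := by
    intro k a
    exact MonoidHom.noncommPiCoprod_mulSingle (ϕ := f) (hcomm := hc) k a
  have hcomm : ∀ x y, F x * F y = F y * F x := by
    intro x y; rw [← map_mul, ← map_mul, mul_comm]
  refine ⟨fun x => F (fun i => Multiplicative.ofAdd (x i)), ?_, ?_, ?_, ?_⟩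
  · exact map_one F
  · intro x
    have hu : ∀ y, F y ∈ Matrix.unitaryGroup I ℂ := by
      intro y
      show MonoidHom.noncommPiCoprod f hc y ∈ _
      rw [MonoidHom.noncommPiCoprod_apply]
      apply Submonoid.noncommProd_mem
      intro k _
      exact pow_mem (Matrix.mem_unitaryGroup_iff'.2 (hXu k)) _
    exact Matrix.mem_unitaryGroup_iff'.1 (hu _)
  · intro k x
    have h := hF k (Multiplicative.ofAdd 1)
    have h1 : X k = F (Pi.mulSingle k (Multiplicative.ofAdd 1)) := by
      rw [h]; simp [ZMod.val_one]
    rw [h1, hcomm, ← map_mul]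
    refine congrArg F ?_
    funext i
    by_cases hi : i = k
    · subst hi; simp
    · simp [hi]
  · intro k x
    let A : (Fin n → Multiplicative (ZMod 2)) →* Matrix I I ℂ :=
      { toFun := fun y => Z k * F y * Z k
        map_one' := by simp [hZ2]
        map_mul' := fun a b => by
          rw [map_mul]
          calc Z k * (F a * F b) * Z k = Z k * F a * 1 * F b * Z k := by simp [mul_assoc]
            _ = _ := by rw [← hZ2 k]; simp [mul_assoc] }
    let B : (Fin n → Multiplicative (ZMod 2)) →* Matrix I I ℂ :=
      { toFun := fun y => (-1 : ℂ) ^ ((y k).toAdd).val • F y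
        map_one' := by simp
        map_mul' := fun a b => by
          rw [map_mul, Pi.mul_apply, toAdd_mul, eps_add, smul_mul_smul_comm] }
    have hAB : A = B := by
      apply MonoidHom.pi_ext
      intro i a
      show Z k * F _ * Z k = (-1 : ℂ) ^ _ • F _
      rw [hF]
      have ha : a.toAdd = 0 ∨ a.toAdd = 1 := by
        generalize a.toAdd = b
        revert b; decide
      rcases ha with ha | ha
      · have : a = 1 := ha
        subst this
        simp [hZ2]
      · rw [ha, ZMod.val_one, pow_one, hZX, smul_mul_assoc, mul_assoc, hZ2, mul_one]
        by_cases hi : k = i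
        · subst hi; simp [ha, ZMod.val_one]
        · simp [hi]
    have := congrArg (fun M => M * Z k) (DFunLike.congr_fun hAB (fun i => Multiplicative.ofAdd (x i)))
    change Z k * F _ * Z k * Z k = ((-1 : ℂ) ^ _ • F _) * Z k at this
    rw [mul_assoc, hZ2, mul_one, smul_mul_assoc] at this
    exact this
end

theorem star_dot_unitary {I : Type*} [Fintype I] [DecidableEq I] (M : Matrix I I ℂ)
    (h : Mᴴ * M = 1) (u v : I → ℂ) : star (M *ᵥ u) ⬝ᵥ (M *ᵥ v) = star u ⬝ᵥ v := by
  rw [star_mulVec, ← dotProduct_mulVec, mulVec_mulVec, h, one_mulVec]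

/-- If unitaries `Q_1, …, Q_{2n}` satisfy `Q_i² = I` and the Pauli
commutation/anticommutation relations `Q_i Q_j = (−1)^{δ_{i+n,j}} Q_j Q_i`,
then there is a unitary `U` with `Q_i = U τ_{e_i} U†` for all `i`. -/
theorem pauli_relations_give_conjugate (n : ℕ) (hn : 1 ≤ n)
    (Q : Fin n ⊕ Fin n → Matrix (Fin n → ZMod 2) (Fin n → ZMod 2) ℂ)
    (hQu : ∀ i, IsUnitaryMat (Q i))
    (hQ2 : ∀ i, Q i * Q i = 1)
    (hQcomm : ∀ i j, Q i * Q j =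
      (if antiPair i j then (-1 : ℂ) else 1) • (Q j * Q i)) :
    ∃ U : Matrix (Fin n → ZMod 2) (Fin n → ZMod 2) ℂ,
      IsUnitaryMat U ∧ ∀ i, Q i = U * tau n (stdBasis n i) * Uᴴ := by
  have key : ∃ U : Matrix (Fin n → ZMod 2) (Fin n → ZMod 2) ℂ,
      Uᴴ * U = 1 ∧ ∀ i, Q i * U = U * tau n (stdBasis n i) := by
    have hZX : ∀ j k, Q (Sum.inl j) * Q (Sum.inr k) =
        (if j = k then (-1 : ℂ) else 1) • (Q (Sum.inr k) * Q (Sum.inl j)) := by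
      intro j k
      have := hQcomm (Sum.inl j) (Sum.inr k)
      by_cases hjk : j = k <;> simpa [antiPair, hjk] using this
    have hZZ : ∀ j k, Q (Sum.inl j) * Q (Sum.inl k) = Q (Sum.inl k) * Q (Sum.inl j) := by
      intro j k
      have := hQcomm (Sum.inl j) (Sum.inl k)
      simpa [antiPair] using this
    have hXX : ∀ j k, Q (Sum.inr j) * Q (Sum.inr k) = Q (Sum.inr k) * Q (Sum.inr j) := by
      intro j k
      have := hQcomm (Sum.inr j) (Sum.inr k)
      simpa [antiPair] using this
    obtain ⟨φ, h0, hφ⟩ := exists_stab (fun k => Q (Sum.inl k)) (fun k => Q (Sum.inr k))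
      (fun k => hQ2 _) (fun k => hQ2 _) hZZ hZX Finset.univ
    obtain ⟨F, hF0, hFu, hFX, hFZ⟩ := exists_hom (fun k => Q (Sum.inl k)) (fun k => Q (Sum.inr k))
      (fun k => (hQu _).2) (fun k => hQ2 _) (fun k => hQ2 _) hXX hZX
    obtain ⟨ψ, hψ1, hψ⟩ : ∃ ψ : (Fin n → ZMod 2) → ℂ, star ψ ⬝ᵥ ψ = 1 ∧
        ∀ k, Q (Sum.inl k) *ᵥ ψ = ψ := by
      let r : ℝ := ∑ i, Complex.normSq (φ i)
      have hr : star φ ⬝ᵥ φ = (r : ℂ) := by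
        simp [dotProduct, r, Complex.normSq_eq_conj_mul_self]
      have hr0 : 0 ≤ r := Finset.sum_nonneg fun i _ => Complex.normSq_nonneg _
      have hr1 : r ≠ 0 := by
        intro h
        apply h0
        funext i
        have := (Finset.sum_eq_zero_iff_of_nonneg
          (fun i _ => Complex.normSq_nonneg (φ i))).1 h i (Finset.mem_univ i)
        exact Complex.normSq_eq_zero.1 this
      refine ⟨((Real.sqrt r)⁻¹ : ℂ) • φ, ?_, ?_⟩
      · rw [star_smul, smul_dotProduct, dotProduct_smul, hr]
        have h2 : ((Real.sqrt r : ℝ) : ℂ) * (Real.sqrt r : ℝ) = r := by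
          rw [← Complex.ofReal_mul, Real.mul_self_sqrt hr0]
        have h3 : ((Real.sqrt r : ℝ) : ℂ) ≠ 0 := by
          intro h; rw [h, zero_mul] at h2
          exact hr1 (by exact_mod_cast h2.symm)
        simp only [smul_eq_mul, star_inv₀, Complex.star_def, Complex.conj_ofReal]
        rw [← h2]
        field_simp
      · intro k
        rw [mulVec_smul, hφ k (Finset.mem_univ _)]
    have hZF : ∀ k x, Q (Sum.inl k) *ᵥ (F x *ᵥ ψ) = (-1 : ℂ) ^ (x k).val • (F x *ᵥ ψ) := by
      intro k x
      have h := hFZ k x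
      rw [mulVec_mulVec, h, smul_mulVec, ← mulVec_mulVec, hψ]
    have hXF : ∀ k x, Q (Sum.inr k) *ᵥ (F x *ᵥ ψ) = F (x + Pi.single k 1) *ᵥ ψ := by
      intro k x
      have h := hFX k x
      rw [mulVec_mulVec, h]
    refine ⟨Matrix.of fun y x => (F x *ᵥ ψ) y, ?_, ?_⟩
    · ext x x'
      change star (F x *ᵥ ψ) ⬝ᵥ (F x' *ᵥ ψ) = _
      by_cases hx : x = x'
      · subst hx
        rw [star_dot_unitary _ (hFu x), hψ1, one_apply_eq]
      · rw [one_apply_ne hx]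
        obtain ⟨k, hk⟩ := Function.ne_iff.1 hx
        have h := star_dot_unitary _ (hQu (Sum.inl k)).2 (F x *ᵥ ψ) (F x' *ᵥ ψ)
        rw [hZF, hZF, star_smul, smul_dotProduct, dotProduct_smul, smul_smul] at h
        have h2 : star ((-1 : ℂ) ^ (x k).val) = (-1) ^ (x k).val := by simp
        rw [h2, eps_ne _ _ hk, neg_one_smul] at h
        exact self_eq_neg.1 h.symm
    · intro i
      ext y x
      change (Q i *ᵥ (F x *ᵥ ψ)) y = ∑ z, (F z *ᵥ ψ) y * tau n (stdBasis n i) z x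
      rcases i with k | k
      · rw [hZF]
        have hw : (fun i => stdBasis n (Sum.inl k) (Sum.inr i)) = 0 := by
          funext i; simp [_root_.stdBasis]
        have hv : (fun i => stdBasis n (Sum.inl k) (Sum.inl i)) = Pi.single k 1 := by
          funext i; simp [_root_.stdBasis, Pi.single_apply]
        simp [tau, hw, hv, mul_comm]
      · rw [hXF]
        have hw : (fun i => stdBasis n (Sum.inr k) (Sum.inr i)) = Pi.single k 1 := by
          funext i; simp [_root_.stdBasis, Pi.single_apply]
        have hv : (fun i => stdBasis n (Sum.inr k) (Sum.inl i)) = 0 := by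
          funext i; simp [_root_.stdBasis]
        simp [tau, hw, hv]
  obtain ⟨U, hU, h⟩ := key
  have hU' : U * Uᴴ = 1 := mul_eq_one_comm.1 hU
  refine ⟨U, ⟨hU', hU⟩, fun i => ?_⟩
  rw [← h, mul_assoc, hU', mul_one]
end

section
/- For every 2n × 2n symplectic involution C over Z_2 (i.e. C^T P C = P and C² = I), there exists a 2n × 2n symplectic matrix M over Z_2 such that M C M⁻¹ has the block form [[I_n, E],[0, I_n]] where E is a symmetric n × n matrix (E^T = E). -/
open Matrix

/-- The matrix `P = [[0, I_n],[I_n, 0]]` over `Z_2`, in `2n × 2n` block form. -/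
def Pm (n : ℕ) : Matrix (Fin n ⊕ Fin n) (Fin n ⊕ Fin n) (ZMod 2) :=
  Matrix.fromBlocks 0 1 1 0

theorem Pm_T (n : ℕ) : (Pm n)ᵀ = Pm n := by
  simp [Pm, fromBlocks_transpose]

theorem Pm_sq (n : ℕ) : Pm n * Pm n = 1 := by
  simp [Pm, fromBlocks_multiply, fromBlocks_one]

theorem Pm_symm (n : ℕ) (x y : Fin n ⊕ Fin n → ZMod 2) :
    x ⬝ᵥ Pm n *ᵥ y = y ⬝ᵥ Pm n *ᵥ x := by
  rw [dotProduct_mulVec, dotProduct_comm, ← mulVec_transpose, Pm_T]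

theorem Pm_alt (n : ℕ) (x : Fin n ⊕ Fin n → ZMod 2) : x ⬝ᵥ Pm n *ᵥ x = 0 := by
  have h : ∀ x : Fin n ⊕ Fin n → ZMod 2, Pm n *ᵥ x = Sum.elim (x ∘ Sum.inr) (x ∘ Sum.inl) := by
    intro x
    simp [Pm, fromBlocks_mulVec]
  rw [h]
  simp only [dotProduct, Fintype.sum_sum_type, Sum.elim_inl, Sum.elim_inr, Function.comp]
  rw [← Finset.sum_add_distrib]
  refine Finset.sum_eq_zero fun i _ => ?_
  rw [mul_comm]; exact CharTwo.add_self_eq_zero _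

theorem exists_lagr (n : ℕ)
    (C : Matrix (Fin n ⊕ Fin n) (Fin n ⊕ Fin n) (ZMod 2))
    (hC : Cᵀ * Pm n = Pm n * C) (hC2 : C * C = 1) :
    ∃ A : Matrix (Fin n ⊕ Fin n) (Fin n) (ZMod 2),
      Aᵀ * Pm n * A = 0 ∧ C * A = A ∧ ∃ D : Matrix (Fin n ⊕ Fin n) (Fin n) (ZMod 2), Aᵀ * Pm n * D = 1 := by
  classical
  have hsymm := Pm_symm n
  have halt := Pm_alt n
  have hadj : ∀ x y, (C *ᵥ x) ⬝ᵥ Pm n *ᵥ y = x ⬝ᵥ Pm n *ᵥ (C *ᵥ y) := by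
    intro x y
    rw [mulVec_mulVec, ← hC, ← mulVec_mulVec, dotProduct_mulVec x, vecMul_transpose]
  have hCC : ∀ x, C *ᵥ (C *ᵥ x) = x := by
    intro x; rw [mulVec_mulVec, hC2, one_mulVec]
  let S : Set (Submodule (ZMod 2) (Fin n ⊕ Fin n → ZMod 2)) :=
    {L | (∀ x, C *ᵥ x + x ∈ L) ∧ ∀ x ∈ L, ∀ y ∈ L, x ⬝ᵥ Pm n *ᵥ y = 0}
  have hne : S.Nonempty := by
    refine ⟨LinearMap.range (Matrix.toLin' C + LinearMap.id), fun x => ⟨x, by simp⟩, ?_⟩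
    rintro _ ⟨x, rfl⟩ _ ⟨y, rfl⟩
    simp only [LinearMap.add_apply, toLin'_apply, LinearMap.id_apply, add_dotProduct, mulVec_add,
      dotProduct_add, hadj, hCC]
    have h1 := CharTwo.add_self_eq_zero (x ⬝ᵥ Pm n *ᵥ y)
    have h2 := CharTwo.add_self_eq_zero (x ⬝ᵥ Pm n *ᵥ (C *ᵥ y))
    linear_combination h1 + h2
  obtain ⟨L, hL⟩ := (Set.toFinite S).exists_maximal hne
  obtain ⟨hLr, hLi⟩ := hL.1
  have hmax : ∀ v, (∀ x ∈ L, x ⬝ᵥ Pm n *ᵥ v = 0) → v ∈ L := by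
    intro v hv
    have hS : L ⊔ Submodule.span (ZMod 2) {v} ∈ S := by
      refine ⟨fun x => Submodule.mem_sup_left (hLr x), ?_⟩
      intro x hx y hy
      obtain ⟨a, ha, b, hb, rfl⟩ := Submodule.mem_sup.1 hx
      obtain ⟨c, hc, d, hd, rfl⟩ := Submodule.mem_sup.1 hy
      obtain ⟨s, rfl⟩ := Submodule.mem_span_singleton.1 hb
      obtain ⟨t, rfl⟩ := Submodule.mem_span_singleton.1 hd
      simp [add_dotProduct, mulVec_add, dotProduct_add, mulVec_smul, hLi a ha c hc, hv a ha,
        hsymm v c, hv c hc, halt]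
    exact hL.2 hS le_sup_left (Submodule.mem_sup_right (Submodule.mem_span_singleton_self v))
  have hfix : ∀ l ∈ L, C *ᵥ l = l := by
    intro l hl
    have h0 : ∀ y, (C *ᵥ l + l) ⬝ᵥ Pm n *ᵥ y = 0 := by
      intro y
      rw [add_dotProduct, hadj, ← dotProduct_add, ← mulVec_add]
      exact hLi l hl _ (hLr y)
    have h1 : C *ᵥ l + l = 0 := by
      apply dotProduct_eq_zero
      intro w
      have := h0 (Pm n *ᵥ w)
      rwa [mulVec_mulVec, Pm_sq, one_mulVec] at this
    funext i
    have := congrFun h1 i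
    exact CharTwo.add_eq_zero.1 this
  have hdim : Module.finrank (ZMod 2) L = n := by
    let B := Matrix.toBilin' (Pm n)
    have hB : B.Nondegenerate := by
      apply Matrix.Nondegenerate.toBilin'
      apply Matrix.nondegenerate_of_det_ne_zero
      intro h
      have := congrArg det (Pm_sq n)
      simp [h] at this
    have h := LinearMap.BilinForm.finrank_orthogonal hB L
    have hO : B.orthogonal L = L := by
      ext v
      rw [LinearMap.BilinForm.mem_orthogonal_iff]
      constructor
      · intro h
        apply hmax
        intro x hx
        have := h x hx
        simpa [LinearMap.BilinForm.IsOrtho, B, toBilin'_apply'] using this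
      · intro hv x hx
        simpa [LinearMap.BilinForm.IsOrtho, B, toBilin'_apply'] using hLi x hx v hv
    rw [hO] at h
    have hle := Submodule.finrank_le L
    simp only [Module.finrank_fintype_fun_eq_card, Fintype.card_sum, Fintype.card_fin] at h hle
    omega
  let b := Module.finBasisOfFinrankEq (ZMod 2) L hdim
  let A : Matrix (Fin n ⊕ Fin n) (Fin n) (ZMod 2) := of fun i j => (b j : Fin n ⊕ Fin n → ZMod 2) i
  have hAc : ∀ j, A.col j = b j := fun j => rfl
  refine ⟨A, ?_, ?_, ?_⟩
  · ext i j
    have := hLi _ (b i).2 _ (b j).2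
    rw [Matrix.mul_assoc]
    exact this
  · ext i j
    exact congrFun (hfix _ (b j).2) i
  · have hli : LinearIndependent (ZMod 2) A.col := by
      have := b.linearIndependent.map' L.subtype (Submodule.ker_subtype L)
      exact this
    have hinj := Matrix.mulVec_injective_iff.2 hli
    obtain ⟨g, hg⟩ := LinearMap.exists_leftInverse_of_injective (Matrix.toLin' A)
      (LinearMap.ker_eq_bot.2 hinj)
    obtain ⟨G, hG⟩ : ∃ G : Matrix (Fin n) (Fin n ⊕ Fin n) (ZMod 2), G * A = 1 := by
      refine ⟨LinearMap.toMatrix' g, ?_⟩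
      have := congrArg LinearMap.toMatrix' hg
      rwa [LinearMap.toMatrix'_comp, LinearMap.toMatrix'_toLin', LinearMap.toMatrix'_id] at this
    refine ⟨Pm n * Gᵀ, ?_⟩
    rw [Matrix.mul_assoc, ← Matrix.mul_assoc (Pm n), Pm_sq, Matrix.one_mul, ← transpose_mul, hG,
      transpose_one]

theorem exists_half (n : ℕ) (S : Matrix (Fin n) (Fin n) (ZMod 2)) (hS : Sᵀ = S)
    (hd : ∀ i, S i i = 0) : ∃ X : Matrix (Fin n) (Fin n) (ZMod 2), S + X + Xᵀ = 0 := by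
  refine ⟨of fun i j => if i < j then S i j else 0, ?_⟩
  ext i j
  have h : S j i = S i j := congrFun (congrFun hS i) j
  simp only [Matrix.add_apply, of_apply, transpose_apply, Matrix.zero_apply]
  rcases lt_trichotomy i j with hij | rfl | hij
  · simp [hij, hij.not_gt, CharTwo.add_self_eq_zero]
  · simp [hd]
  · simp [hij, hij.not_gt, h, CharTwo.add_self_eq_zero]

/-- Every `2n × 2n` symplectic involution `C` over `Z_2` is symplectically
conjugate to a matrix of the form `[[I, E],[0, I]]` with `E` symmetric. -/
theorem symplectic_involution_normal_form (n : ℕ) (hn : 1 ≤ n)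
    (C : Matrix (Fin n ⊕ Fin n) (Fin n ⊕ Fin n) (ZMod 2))
    (hC : Cᵀ * Pm n * C = Pm n) (hC2 : C * C = 1) :
    ∃ M : Matrix (Fin n ⊕ Fin n) (Fin n ⊕ Fin n) (ZMod 2),
      Mᵀ * Pm n * M = Pm n ∧
      ∃ E : Matrix (Fin n) (Fin n) (ZMod 2), Eᵀ = E ∧
        M * C * M⁻¹ = Matrix.fromBlocks 1 E 0 1 := by
  have hPC : Cᵀ * Pm n = Pm n * C := by
    calc Cᵀ * Pm n = Cᵀ * Pm n * (C * C) := by rw [hC2, Matrix.mul_one]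
      _ = Cᵀ * Pm n * C * C := by simp only [Matrix.mul_assoc]
      _ = _ := by rw [hC]
  obtain ⟨A, hA, hCA, D0, hD0⟩ := exists_lagr n C hPC hC2
  have hD0' : D0ᵀ * Pm n * A = 1 := by
    have := congrArg transpose hD0
    simpa [transpose_mul, Pm_T, Matrix.mul_assoc] using this
  obtain ⟨X, hX⟩ := exists_half n (D0ᵀ * Pm n * D0)
    (by simp [transpose_mul, Pm_T, Matrix.mul_assoc])
    (fun i => by rw [Matrix.mul_assoc]; exact Pm_alt n (D0.col i))
  obtain ⟨D, hD⟩ : ∃ D, D = D0 + A * X := ⟨_, rfl⟩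
  have hAD : Aᵀ * Pm n * D = 1 := by
    rw [hD, Matrix.mul_add, hD0, ← Matrix.mul_assoc, hA]; simp
  have hDA : Dᵀ * Pm n * A = 1 := by
    have := congrArg transpose hAD
    simpa [transpose_mul, Pm_T, Matrix.mul_assoc] using this
  have hDD : Dᵀ * Pm n * D = 0 := by
    have e : Dᵀ * Pm n * D = D0ᵀ * Pm n * D0 + (D0ᵀ * Pm n * A) * X
        + Xᵀ * (Aᵀ * Pm n * D) := by
      rw [hD]
      simp only [transpose_add, transpose_mul, Matrix.add_mul, Matrix.mul_add, Matrix.mul_assoc]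
      abel
    rw [e, hD0', hAD, Matrix.one_mul, Matrix.mul_one, hX]
  let Q : Matrix (Fin n ⊕ Fin n) (Fin n ⊕ Fin n) (ZMod 2) := fromCols A D
  have hQ : Qᵀ * Pm n * Q = Pm n := by
    simp only [Q, transpose_fromCols, fromRows_mul, mul_fromCols, fromCols_fromRows_eq_fromBlocks, hA, hAD, hDA, hDD]
    rfl
  have hinv : (Pm n * Qᵀ * Pm n) * Q = 1 := by
    rw [Matrix.mul_assoc, Matrix.mul_assoc, ← Matrix.mul_assoc Qᵀ, hQ, Pm_sq]
  have hinv' : Q * (Pm n * Qᵀ * Pm n) = 1 := mul_eq_one_comm.1 hinv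
  refine ⟨Pm n * Qᵀ * Pm n, ?_, Dᵀ * Pm n * C * D, ?_, ?_⟩
  · have h2 : Q * Pm n * Qᵀ = Pm n := by
      calc Q * Pm n * Qᵀ = (Q * (Pm n * Qᵀ * Pm n)) * Pm n := by
            simp only [Matrix.mul_assoc, Pm_sq, Matrix.mul_one]
        _ = _ := by rw [hinv', Matrix.one_mul]
    calc (Pm n * Qᵀ * Pm n)ᵀ * Pm n * (Pm n * Qᵀ * Pm n)
        = Pm n * Q * (Pm n * (Pm n * Pm n)) * Qᵀ * Pm n := by
          simp only [transpose_mul, Pm_T, transpose_transpose, Matrix.mul_assoc]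
      _ = Pm n * (Q * Pm n * Qᵀ) * Pm n := by
          rw [Pm_sq, Matrix.mul_one]; simp only [Matrix.mul_assoc]
      _ = Pm n := by rw [h2, Pm_sq, Matrix.one_mul]
  · simp only [transpose_mul, transpose_transpose, Pm_T]
    rw [← Matrix.mul_assoc Cᵀ, hPC]
    simp only [Matrix.mul_assoc]
  · rw [inv_eq_right_inv hinv]
    have h1 : Aᵀ * Pm n * C = Aᵀ * Pm n := by
      rw [Matrix.mul_assoc, ← hPC, ← Matrix.mul_assoc, ← transpose_mul, hCA]
    have h3 : Qᵀ * Pm n * C * Q = fromBlocks 0 1 1 (Dᵀ * Pm n * C * D) := by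
      simp only [Q, transpose_fromCols, fromRows_mul, mul_fromCols, fromCols_fromRows_eq_fromBlocks, h1, hA, hAD]
      rw [Matrix.mul_assoc _ C A, hCA, hDA]
    calc Pm n * Qᵀ * Pm n * C * Q = Pm n * (Qᵀ * Pm n * C * Q) := by
          simp only [Matrix.mul_assoc]
      _ = _ := by rw [h3]; simp [Pm, fromBlocks_multiply]
end

section
/- Over Z_2 (with n = 2), let C_1 = [[1,0,0,1],[0,1,1,0],[0,0,1,0],[0,0,0,1]] and C_2 = [[1,1,0,0],[0,1,0,0],[0,0,1,0],[0,0,1,1]]. Then C_1 and C_2 are symplectic involutions that commute with each other, yet there exists no 4 × 4 symplectic matrix M over Z_2 such that both M C_1 M⁻¹ and M C_2 M⁻¹ have the block form [[I_2, E],[0, I_2]] (with E a 2 × 2 matrix); indeed any two matrices of that block form N_1, N_2 satisfy (I + N_1)(I + N_2) = 0, whereas (I + C_1)(I + C_2) ≠ 0. -/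
open Matrix

/-- The matrix `P = [[0, I_2],[I_2, 0]]` over `Z_2`, in `4 × 4` block form. -/
def Pm2 : Matrix (Fin 2 ⊕ Fin 2) (Fin 2 ⊕ Fin 2) (ZMod 2) :=
  Matrix.fromBlocks 0 1 1 0

/-- `C_1 = [[1,0,0,1],[0,1,1,0],[0,0,1,0],[0,0,0,1]]` in `2 × 2` block form. -/
def C₁ : Matrix (Fin 2 ⊕ Fin 2) (Fin 2 ⊕ Fin 2) (ZMod 2) :=
  Matrix.fromBlocks 1 !![0, 1; 1, 0] 0 1

/-- `C_2 = [[1,1,0,0],[0,1,0,0],[0,0,1,0],[0,0,1,1]]` in `2 × 2` block form. -/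
def C₂ : Matrix (Fin 2 ⊕ Fin 2) (Fin 2 ⊕ Fin 2) (ZMod 2) :=
  Matrix.fromBlocks !![1, 1; 0, 1] 0 0 !![1, 0; 1, 1]

/-- `C_1, C_2` are commuting symplectic involutions over `Z_2` which cannot be
simultaneously symplectically conjugated to the form `[[I, E],[0, I]]`; indeed any
two matrices `N_1, N_2` of that form satisfy `(I + N_1)(I + N_2) = 0`, whereas
`(I + C_1)(I + C_2) ≠ 0`. -/
theorem commuting_involutions_counterexample :
    (C₁ᵀ * Pm2 * C₁ = Pm2) ∧ (C₁ * C₁ = 1) ∧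
    (C₂ᵀ * Pm2 * C₂ = Pm2) ∧ (C₂ * C₂ = 1) ∧
    (C₁ * C₂ = C₂ * C₁) ∧
    (¬ ∃ M : Matrix (Fin 2 ⊕ Fin 2) (Fin 2 ⊕ Fin 2) (ZMod 2),
        Mᵀ * Pm2 * M = Pm2 ∧
        (∃ E : Matrix (Fin 2) (Fin 2) (ZMod 2),
          M * C₁ * M⁻¹ = Matrix.fromBlocks 1 E 0 1) ∧
        (∃ E : Matrix (Fin 2) (Fin 2) (ZMod 2),
          M * C₂ * M⁻¹ = Matrix.fromBlocks 1 E 0 1)) ∧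
    (∀ E₁ E₂ : Matrix (Fin 2) (Fin 2) (ZMod 2),
      ((1 : Matrix (Fin 2 ⊕ Fin 2) (Fin 2 ⊕ Fin 2) (ZMod 2)) + Matrix.fromBlocks 1 E₁ 0 1) *
        ((1 : Matrix (Fin 2 ⊕ Fin 2) (Fin 2 ⊕ Fin 2) (ZMod 2)) + Matrix.fromBlocks 1 E₂ 0 1) = 0) ∧
    ((1 + C₁) * (1 + C₂) ≠ 0) := by
  have hP : Pm2 * Pm2 = 1 := by decide
  have hne : (1 + C₁) * (1 + C₂) ≠ 0 := by decide
  have hN : ∀ E₁ E₂ : Matrix (Fin 2) (Fin 2) (ZMod 2),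
      ((1 : Matrix (Fin 2 ⊕ Fin 2) (Fin 2 ⊕ Fin 2) (ZMod 2)) + Matrix.fromBlocks 1 E₁ 0 1) *
        ((1 : Matrix (Fin 2 ⊕ Fin 2) (Fin 2 ⊕ Fin 2) (ZMod 2)) +
          Matrix.fromBlocks 1 E₂ 0 1) = 0 := by
    intro E₁ E₂
    have h2 : (1 : Matrix (Fin 2) (Fin 2) (ZMod 2)) + 1 = 0 := by decide
    rw [← Matrix.fromBlocks_one, Matrix.fromBlocks_add, Matrix.fromBlocks_add,
      Matrix.fromBlocks_multiply, h2]
    simp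
  refine ⟨by decide, by decide, by decide, by decide, by decide, ?_, hN, hne⟩
  rintro ⟨M, hM, ⟨E₁, h₁⟩, ⟨E₂, h₂⟩⟩
  have hl : (Pm2 * Mᵀ * Pm2) * M = 1 := by
    rw [Matrix.mul_assoc, Matrix.mul_assoc, ← Matrix.mul_assoc Mᵀ, hM, hP]
  have hinv : M⁻¹ = Pm2 * Mᵀ * Pm2 := Matrix.inv_eq_left_inv hl
  have hlM : M⁻¹ * M = 1 := by rw [hinv]; exact hl
  have hrM : M * M⁻¹ = 1 := mul_eq_one_comm.mp hlM
  have key : ∀ C, M⁻¹ * (1 + M * C * M⁻¹) * M = 1 + C := by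
    intro C
    calc M⁻¹ * (1 + M * C * M⁻¹) * M
        = M⁻¹ * M + (M⁻¹ * M) * C * (M⁻¹ * M) := by noncomm_ring
      _ = 1 + C := by rw [hlM]; simp
  apply hne
  rw [← key C₁, ← key C₂, h₁, h₂]
  set N₁ := (1 : Matrix (Fin 2 ⊕ Fin 2) (Fin 2 ⊕ Fin 2) (ZMod 2)) +
    Matrix.fromBlocks 1 E₁ 0 1 with hN₁
  set N₂ := (1 : Matrix (Fin 2 ⊕ Fin 2) (Fin 2 ⊕ Fin 2) (ZMod 2)) +
    Matrix.fromBlocks 1 E₂ 0 1 with hN₂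
  have h0 : N₁ * N₂ = 0 := hN E₁ E₂
  calc M⁻¹ * N₁ * M * (M⁻¹ * N₂ * M) = M⁻¹ * N₁ * (M * M⁻¹) * N₂ * M := by
        simp only [Matrix.mul_assoc]
    _ = M⁻¹ * (N₁ * N₂) * M := by rw [hrM, Matrix.mul_one, Matrix.mul_assoc M⁻¹]
    _ = 0 := by rw [h0]; simp
end

section
/- Let C be a 2n × 2n symplectic matrix over Z_2, written in block form C = [[A, E],[F, B]] with n × n blocks, and let b = (x, y) and b' = (x', y') be vectors in Z_2^{2n} fixed by C (i.e. Cb = b and Cb' = b'). Then x'^T F^T x + y'^T E^T y = 0. In particular, for d = diag(C^T J C) one has d·b = 0 for every b ∈ Z_2^{2n} with Cb = b. -/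
open Matrix

/-- The matrix `J = [[0, I_n],[0, 0]]` over `Z_2`, in `2n × 2n` block form. -/
def Jm (n : ℕ) : Matrix (Fin n ⊕ Fin n) (Fin n ⊕ Fin n) (ZMod 2) :=
  Matrix.fromBlocks 0 1 0 0

lemma diag_dot_of_symm {n : ℕ} (M : Matrix (Fin n) (Fin n) (ZMod 2)) (hM : Mᵀ = M)
    (x : Fin n → ZMod 2) : Matrix.diag M ⬝ᵥ x = x ⬝ᵥ M.mulVec x := by
  let f : (Fin n → ZMod 2) →+ ZMod 2 :=
    { toFun := fun v => Matrix.diag M ⬝ᵥ v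
      map_zero' := by simp
      map_add' := fun u v => by simp [dotProduct_add] }
  let g : (Fin n → ZMod 2) →+ ZMod 2 :=
    { toFun := fun v => v ⬝ᵥ M.mulVec v
      map_zero' := by simp
      map_add' := fun u v => by
        have h : v ⬝ᵥ M.mulVec u = u ⬝ᵥ M.mulVec v := by
          rw [dotProduct_mulVec, ← mulVec_transpose, hM, dotProduct_comm]
        simp only [Matrix.mulVec_add, dotProduct_add, add_dotProduct, h]
        have h2 := CharTwo.add_self_eq_zero (u ⬝ᵥ M.mulVec v)
        linear_combination h2 }
  have hfg : f = g := by
    apply AddMonoidHom.functions_ext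
    intro i c
    change Matrix.diag M ⬝ᵥ Pi.single i c = Pi.single i c ⬝ᵥ M.mulVec (Pi.single i c)
    simp only [dotProduct_single, single_dotProduct, Matrix.mulVec_single, Matrix.diag_apply]
    have hc : ∀ m c : ZMod 2, m * c = c * (m * c) := by decide
    simpa using hc (M i i) c
  exact DFunLike.congr_fun hfg x

/-- For a symplectic matrix `C = [[A, E],[F, B]]` over `Z_2` and vectors
`b = (x, y)`, `b' = (x', y')` fixed by `C`, one has `x'ᵀ Fᵀ x + y'ᵀ Eᵀ y = 0`;
in particular `d·b = 0` for `d = diag(Cᵀ J C)` and every `b` fixed by `C`. -/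
theorem symplectic_fixed_vectors (n : ℕ) (hn : 1 ≤ n)
    (A E F B : Matrix (Fin n) (Fin n) (ZMod 2))
    (hsymp : (Matrix.fromBlocks A E F B)ᵀ * Pm n * Matrix.fromBlocks A E F B = Pm n)
    (x y x' y' : Fin n → ZMod 2)
    (hb : (Matrix.fromBlocks A E F B).mulVec (Sum.elim x y) = Sum.elim x y)
    (hb' : (Matrix.fromBlocks A E F B).mulVec (Sum.elim x' y') = Sum.elim x' y') :
    x' ⬝ᵥ Fᵀ.mulVec x + y' ⬝ᵥ Eᵀ.mulVec y = 0 ∧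
    ∀ b : Fin n ⊕ Fin n → ZMod 2,
      (Matrix.fromBlocks A E F B).mulVec b = b →
      Matrix.diag ((Matrix.fromBlocks A E F B)ᵀ * Jm n *
        Matrix.fromBlocks A E F B) ⬝ᵥ b = 0 := by
  have two : (2 : ZMod 2) = 0 := by decide
  unfold Pm at hsymp
  rw [Matrix.fromBlocks_transpose, Matrix.fromBlocks_multiply, Matrix.fromBlocks_multiply,
    Matrix.fromBlocks_inj] at hsymp
  simp only [Matrix.mul_zero, Matrix.mul_one, zero_add, add_zero] at hsymp
  obtain ⟨h11, h12, h21, h22⟩ := hsymp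
  have key : ∀ x y x' y' : Fin n → ZMod 2,
      A.mulVec x + E.mulVec y = x → F.mulVec x + B.mulVec y = y →
      A.mulVec x' + E.mulVec y' = x' →
      x' ⬝ᵥ Fᵀ.mulVec x + y' ⬝ᵥ Eᵀ.mulVec y = 0 := by
    intro x y x' y' h1 h2 h3
    have t1 : Fᵀ.mulVec x + Aᵀ.mulVec y = y := by
      calc Fᵀ.mulVec x + Aᵀ.mulVec y
          = Fᵀ.mulVec (A.mulVec x + E.mulVec y) + Aᵀ.mulVec (F.mulVec x + B.mulVec y) := by
            rw [h1, h2]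
        _ = (Fᵀ * A + Aᵀ * F).mulVec x + (Fᵀ * E + Aᵀ * B).mulVec y := by
            simp only [Matrix.mulVec_add, Matrix.add_mulVec, Matrix.mulVec_mulVec]
            abel
        _ = y := by rw [h11, h12]; simp
    have e1 : x' ⬝ᵥ Fᵀ.mulVec x + x' ⬝ᵥ Aᵀ.mulVec y = x' ⬝ᵥ y := by
      rw [← dotProduct_add, t1]
    have e2 : A.mulVec x' ⬝ᵥ y + E.mulVec y' ⬝ᵥ y = x' ⬝ᵥ y := by
      rw [← add_dotProduct, h3]
    rw [dotProduct_mulVec x' Aᵀ, vecMul_transpose] at e1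
    rw [dotProduct_mulVec y' Eᵀ, vecMul_transpose]
    linear_combination e1 + e2 + (x' ⬝ᵥ y - A.mulVec x' ⬝ᵥ y) * two
  have split : ∀ x y : Fin n → ZMod 2,
      (Matrix.fromBlocks A E F B).mulVec (Sum.elim x y) = Sum.elim x y →
      A.mulVec x + E.mulVec y = x ∧ F.mulVec x + B.mulVec y = y := by
    intro x y h
    rw [Matrix.fromBlocks_mulVec] at h
    exact ⟨funext fun i => by simpa using congrFun h (Sum.inl i),
      funext fun i => by simpa using congrFun h (Sum.inr i)⟩
  refine ⟨key x y x' y' (split x y hb).1 (split x y hb).2 (split x' y' hb').1, ?_⟩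
  intro b hb0
  obtain ⟨u, v, rfl⟩ : ∃ u v : Fin n → ZMod 2, b = Sum.elim u v :=
    ⟨b ∘ Sum.inl, b ∘ Sum.inr, (Sum.elim_comp_inl_inr b).symm⟩
  obtain ⟨h1, h2⟩ := split u v hb0
  have k := key u v u v h1 h2 h1
  have sym : ∀ X Y : Matrix (Fin n) (Fin n) (ZMod 2), Yᵀ * X + Xᵀ * Y = 0 →
      (Xᵀ * Y)ᵀ = Xᵀ * Y := by
    intro X Y h
    rw [Matrix.transpose_mul, Matrix.transpose_transpose]
    ext i j
    have := congrFun (congrFun h i) j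
    rw [Matrix.add_apply, Matrix.zero_apply] at this
    exact CharTwo.add_eq_zero.mp this
  have d1 := diag_dot_of_symm (Aᵀ * F) (sym A F h11) u
  have d2 := diag_dot_of_symm (Eᵀ * B) (sym E B h22) v
  rw [← Matrix.mulVec_mulVec, dotProduct_mulVec, vecMul_transpose] at d1 d2
  have hd : Matrix.diag ((Matrix.fromBlocks A E F B)ᵀ * Jm n * Matrix.fromBlocks A E F B) ⬝ᵥ
      Sum.elim u v = Matrix.diag (Aᵀ * F) ⬝ᵥ u + Matrix.diag (Eᵀ * B) ⬝ᵥ v := by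
    unfold Jm
    rw [Matrix.fromBlocks_transpose, Matrix.fromBlocks_multiply, Matrix.fromBlocks_multiply]
    simp [dotProduct, Fintype.sum_sum_type, Matrix.diag]
  rw [hd, d1, d2]
  rw [dotProduct_mulVec u, vecMul_transpose, dotProduct_mulVec v, vecMul_transpose] at k
  have e1 : A.mulVec u ⬝ᵥ F.mulVec u + E.mulVec v ⬝ᵥ F.mulVec u = F.mulVec u ⬝ᵥ u := by
    rw [← add_dotProduct, h1, dotProduct_comm]
  have e2 : E.mulVec v ⬝ᵥ F.mulVec u + E.mulVec v ⬝ᵥ B.mulVec v = E.mulVec v ⬝ᵥ v := by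
    rw [← dotProduct_add, h2]
  linear_combination e1 + e2 + k - (E.mulVec v ⬝ᵥ F.mulVec u) * two
end

section
/- Let C be a 2n × 2n symplectic matrix over Z_2, let d = diag(C^T J C), and define S(b) = b^T lows(C^T J C + d d^T) b ∈ Z_2 for b ∈ Z_2^{2n}. Then the restriction of S to the eigenspace {b ∈ Z_2^{2n} : Cb = b} is linear: S(b + b') = S(b) + S(b') for all b, b' fixed by C. Consequently, there exists a vector α ∈ Z_2^{2n} such that S(b) = α·b for every b with Cb = b. -/
open Matrix

/-- The position in `{0, 1, …, 2n−1}` of an index of `Z_2^{2n} = Z_2^n × Z_2^n`: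
`Sum.inl i ↦ i` and `Sum.inr i ↦ n + i`. -/
def sidx {n : ℕ} : Fin n ⊕ Fin n → ℕ :=
  Sum.elim (fun i => (i : ℕ)) (fun i => n + (i : ℕ))

/-- The strictly lower triangular part of a `2n × 2n` matrix (with rows and
columns ordered as `Sum.inl 0, …, Sum.inl (n−1), Sum.inr 0, …, Sum.inr (n−1)`). -/
def lows {n : ℕ} (M : Matrix (Fin n ⊕ Fin n) (Fin n ⊕ Fin n) (ZMod 2)) :
    Matrix (Fin n ⊕ Fin n) (Fin n ⊕ Fin n) (ZMod 2) :=
  Matrix.of fun i j => if sidx j < sidx i then M i j else 0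


theorem aux_sym_quad {ι : Type*} [Fintype ι] [DecidableEq ι] (N : Matrix ι ι (ZMod 2))
    (hN : ∀ i j, N i j = N j i) (b : ι → ZMod 2) :
    b ⬝ᵥ N.mulVec b = Matrix.diag N ⬝ᵥ b := by
  have h1 : b ⬝ᵥ N.mulVec b = ∑ p : ι × ι, b p.1 * N p.1 p.2 * b p.2 := by
    simp only [dotProduct, mulVec, Fintype.sum_prod_type, Finset.mul_sum, mul_assoc]
  have h2 : Matrix.diag N ⬝ᵥ b =
      ∑ p : ι × ι, if p.1 = p.2 then b p.1 * N p.1 p.2 * b p.2 else 0 := by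
    simp only [dotProduct, Fintype.sum_prod_type, Finset.sum_ite_eq, Finset.mem_univ, if_true,
      Matrix.diag_apply]
    refine Finset.sum_congr rfl fun i _ => ?_
    generalize N i i = x
    generalize b i = y
    revert x y
    decide
  have h3 : ∑ p : ι × ι, (b p.1 * N p.1 p.2 * b p.2 -
      if p.1 = p.2 then b p.1 * N p.1 p.2 * b p.2 else 0) = 0 := by
    refine Finset.sum_involution (fun p _ => p.swap) ?_ ?_ ?_ ?_
    · rintro ⟨i, j⟩ _
      simp only [Prod.swap]
      rw [hN j i]
      by_cases h : i = j
      · subst h; simp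
      · rw [if_neg h, if_neg (Ne.symm h)]
        generalize N i j = x
        generalize b i = y
        generalize b j = z
        revert x y z
        decide
    · rintro ⟨i, j⟩ _ hne heq
      apply hne
      simp only [Prod.swap, Prod.mk.injEq] at heq
      simp [heq.2]
    · simp
    · simp
  rw [Finset.sum_sub_distrib, sub_eq_zero] at h3
  rw [h1, h2, h3]

theorem aux_PJ (n : ℕ) : Pm n = Jm n + (Jm n)ᵀ := by
  simp [Pm, Jm, Matrix.fromBlocks_transpose, Matrix.fromBlocks_add]

theorem aux_MP (n : ℕ) (C : Matrix (Fin n ⊕ Fin n) (Fin n ⊕ Fin n) (ZMod 2))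
    (hsymp : Cᵀ * Pm n * C = Pm n) :
    Cᵀ * Jm n * C + (Cᵀ * Jm n * C)ᵀ = Jm n + (Jm n)ᵀ := by
  rw [← aux_PJ, ← hsymp, aux_PJ]
  simp only [Matrix.transpose_mul, Matrix.transpose_transpose, Matrix.mul_add, Matrix.add_mul,
    Matrix.mul_assoc]

theorem aux_quad {n : ℕ} (C : Matrix (Fin n ⊕ Fin n) (Fin n ⊕ Fin n) (ZMod 2))
    (b b' : Fin n ⊕ Fin n → ZMod 2) (hb : C.mulVec b = b) (hb' : C.mulVec b' = b') :
    b ⬝ᵥ (Cᵀ * Jm n * C).mulVec b' = b ⬝ᵥ (Jm n).mulVec b' := by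
  rw [← Matrix.mulVec_mulVec, ← Matrix.mulVec_mulVec, hb', Matrix.dotProduct_mulVec,
    Matrix.vecMul_transpose, hb]

theorem aux_d {n : ℕ} (C : Matrix (Fin n ⊕ Fin n) (Fin n ⊕ Fin n) (ZMod 2))
    (hsymp : Cᵀ * Pm n * C = Pm n)
    (b : Fin n ⊕ Fin n → ZMod 2) (hb : C.mulVec b = b) :
    Matrix.diag (Cᵀ * Jm n * C) ⬝ᵥ b = 0 := by
  have h := aux_sym_quad (Cᵀ * Jm n * C + Jm n) (fun i j => by
    have := congrFun (congrFun (aux_MP n C hsymp) i) j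
    simp only [Matrix.add_apply, Matrix.transpose_apply] at this ⊢
    revert this
    generalize (Cᵀ * Jm n * C) i j = x
    generalize (Cᵀ * Jm n * C) j i = y
    generalize Jm n i j = z
    generalize Jm n j i = w
    revert x y z w
    decide) b
  rw [Matrix.add_mulVec, dotProduct_add, aux_quad C b b hb hb, CharTwo.add_self_eq_zero] at h
  rw [h]
  congr 1
  ext i
  rcases i with i | i <;> simp [Jm]

theorem aux_sidx_inj {n : ℕ} : Function.Injective (sidx (n := n)) := by
  rintro (i | i) (j | j) h <;> simp only [sidx, Sum.elim_inl, Sum.elim_inr] at h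
  · rw [Fin.ext h]
  · omega
  · omega
  · rw [Fin.ext (by omega : (i : ℕ) = j)]

theorem aux_J_lower {n : ℕ} (i j : Fin n ⊕ Fin n) (h : sidx j ≤ sidx i) : Jm n i j = 0 := by
  rcases i with i | i <;> rcases j with j | j <;>
    simp only [sidx, Sum.elim_inl, Sum.elim_inr] at h <;> simp [Jm]
  omega

theorem aux_lows {n : ℕ} (C : Matrix (Fin n ⊕ Fin n) (Fin n ⊕ Fin n) (ZMod 2))
    (hsymp : Cᵀ * Pm n * C = Pm n) (d : Fin n ⊕ Fin n → ZMod 2)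
    (hd : d = Matrix.diag (Cᵀ * Jm n * C)) :
    lows (Cᵀ * Jm n * C + Matrix.vecMulVec d d) + (lows (Cᵀ * Jm n * C + Matrix.vecMulVec d d))ᵀ
      = Cᵀ * Jm n * C + Matrix.vecMulVec d d + Jm n := by
  ext i j
  have h := congrFun (congrFun (aux_MP n C hsymp) i) j
  simp only [Matrix.add_apply, Matrix.transpose_apply, lows, Matrix.of_apply,
    Matrix.vecMulVec_apply] at h ⊢
  rcases lt_trichotomy (sidx i) (sidx j) with hl | hl | hl
  · rw [if_neg (by omega), if_pos hl]
    rw [aux_J_lower j i hl.le] at h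
    rw [mul_comm (d j)]
    revert h
    generalize (Cᵀ * Jm n * C) i j = x
    generalize (Cᵀ * Jm n * C) j i = y
    generalize Jm n i j = z
    generalize d i * d j = w
    revert x y z w
    decide
  · obtain rfl := aux_sidx_inj hl
    rw [aux_J_lower i i le_rfl, hd]
    simp only [lt_irrefl, if_false, Matrix.diag_apply]
    generalize (Cᵀ * Jm n * C) i i = x
    revert x
    decide
  · rw [if_pos hl, if_neg (by omega), aux_J_lower i j hl.le]

theorem aux_add {n : ℕ} (C : Matrix (Fin n ⊕ Fin n) (Fin n ⊕ Fin n) (ZMod 2))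
    (hsymp : Cᵀ * Pm n * C = Pm n) (d : Fin n ⊕ Fin n → ZMod 2)
    (hd : d = Matrix.diag (Cᵀ * Jm n * C)) (L : Matrix (Fin n ⊕ Fin n) (Fin n ⊕ Fin n) (ZMod 2))
    (hL : L = lows (Cᵀ * Jm n * C + Matrix.vecMulVec d d))
    (b b' : Fin n ⊕ Fin n → ZMod 2) (hb : C.mulVec b = b) (hb' : C.mulVec b' = b') :
    (b + b') ⬝ᵥ L.mulVec (b + b') = b ⬝ᵥ L.mulVec b + b' ⬝ᵥ L.mulVec b' := by
  have h := congrArg (fun X => b ⬝ᵥ X.mulVec b') (aux_lows C hsymp d hd)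
  simp only [← hL] at h
  rw [Matrix.add_mulVec, Matrix.add_mulVec, Matrix.add_mulVec, dotProduct_add, dotProduct_add,
    dotProduct_add, aux_quad C b b' hb hb', Matrix.vecMulVec_mulVec, hd, aux_d C hsymp b' hb',
    Matrix.mulVec_transpose, dotProduct_comm b (b' ᵥ* L), ← Matrix.dotProduct_mulVec] at h
  simp only [MulOpposite.op_zero, zero_smul, dotProduct_zero, add_zero,
    CharTwo.add_self_eq_zero] at h
  rw [Matrix.mulVec_add, dotProduct_add, add_dotProduct, add_dotProduct]
  linear_combination h

/-- For a symplectic `C` over `Z_2` with `d = diag(Cᵀ J C)`, the quadratic form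
`S(b) = bᵀ lows(Cᵀ J C + d dᵀ) b` is linear on the eigenspace `{b : Cb = b}`;
hence it is given there by a dot product with a fixed vector `α`. -/
theorem lows_form_linear_on_fixed_space (n : ℕ) (hn : 1 ≤ n)
    (C : Matrix (Fin n ⊕ Fin n) (Fin n ⊕ Fin n) (ZMod 2))
    (hsymp : Cᵀ * Pm n * C = Pm n) :
    (∀ b b' : Fin n ⊕ Fin n → ZMod 2, C.mulVec b = b → C.mulVec b' = b' →
      (b + b') ⬝ᵥ (lows (Cᵀ * Jm n * C +
          Matrix.vecMulVec (Matrix.diag (Cᵀ * Jm n * C))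
            (Matrix.diag (Cᵀ * Jm n * C)))).mulVec (b + b') =
        b ⬝ᵥ (lows (Cᵀ * Jm n * C +
          Matrix.vecMulVec (Matrix.diag (Cᵀ * Jm n * C))
            (Matrix.diag (Cᵀ * Jm n * C)))).mulVec b +
        b' ⬝ᵥ (lows (Cᵀ * Jm n * C +
          Matrix.vecMulVec (Matrix.diag (Cᵀ * Jm n * C))
            (Matrix.diag (Cᵀ * Jm n * C)))).mulVec b') ∧
    ∃ α : Fin n ⊕ Fin n → ZMod 2, ∀ b : Fin n ⊕ Fin n → ZMod 2, C.mulVec b = b →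
      b ⬝ᵥ (lows (Cᵀ * Jm n * C +
          Matrix.vecMulVec (Matrix.diag (Cᵀ * Jm n * C))
            (Matrix.diag (Cᵀ * Jm n * C)))).mulVec b = α ⬝ᵥ b := by

  have hadd := aux_add C hsymp _ rfl _ rfl
  refine ⟨hadd, ?_⟩
  generalize lows (Cᵀ * Jm n * C + Matrix.vecMulVec (Matrix.diag (Cᵀ * Jm n * C))
            (Matrix.diag (Cᵀ * Jm n * C))) = L at hadd ⊢
  let V : Submodule (ZMod 2) (Fin n ⊕ Fin n → ZMod 2) :=
    LinearMap.eqLocus C.mulVecLin LinearMap.id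
  have hV : ∀ b, b ∈ V ↔ C.mulVec b = b := fun b => by simp [V, LinearMap.mem_eqLocus]
  let f : V →+ ZMod 2 :=
    { toFun := fun b => b.1 ⬝ᵥ L.mulVec b.1
      map_zero' := by simp
      map_add' := fun x y => hadd x.1 y.1 ((hV _).1 x.2) ((hV _).1 y.2) }
  obtain ⟨g, hg⟩ := LinearMap.exists_extend (f.toZModLinearMap 2)
  refine ⟨fun i => g (Pi.single i 1), fun b hb => ?_⟩
  have h1 := LinearMap.congr_fun hg ⟨b, (hV b).2 hb⟩
  have h2 : g b = b ⬝ᵥ L.mulVec b := h1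
  rw [← h2, LinearMap.pi_apply_eq_sum_univ g b]
  simp only [dotProduct, smul_eq_mul]
  refine Finset.sum_congr rfl fun i _ => ?_
  rw [mul_comm]
  congr 2
  ext j
  simp [Pi.single_apply, eq_comm]
end

section
/- Let Q and Q' be unitaries on H_n with Q² = Q'² = I, and suppose there exist n × n matrices A and A' over Z_2 such that for every a_1 ∈ Z_2^n: Q τ_{(a_1,0)} Q = τ_{(A a_1, 0)} and Q' τ_{(a_1,0)} Q' = τ_{(A' a_1, 0)} (this is the case f = f' = 0 of the representation of Clifford involutions). If Q Q' = ε Q' Q for some ε ∈ {+1, −1}, then ε = +1; that is, Q and Q' commute. -/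
open Matrix

theorem row_zero (n : ℕ)
    (Q : Matrix (Fin n → ZMod 2) (Fin n → ZMod 2) ℂ)
    (hQ2 : Q * Q = 1)
    (A : Matrix (Fin n) (Fin n) (ZMod 2))
    (hQA : ∀ a₁ : Fin n → ZMod 2,
      Q * tau n (Sum.elim a₁ 0) * Q = tau n (Sum.elim (A.mulVec a₁) 0))
    (x : Fin n → ZMod 2) (hx : x ≠ 0) : Q 0 x = 0 := by
  have tau_diag : ∀ a : Fin n → ZMod 2, tau n (Sum.elim a 0) =
      Matrix.diagonal (fun y => (-1 : ℂ) ^ ((a ⬝ᵥ y).val)) := by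
    intro a
    ext y z
    have h0 : (fun _ : Fin n => (0 : ZMod 2)) = 0 := rfl
    have h4 : (fun i => a i) = a := rfl
    by_cases h : y = z
    · subst h
      simp [tau, h0, h4]
    · simp [tau, h0, h]
  obtain ⟨i, hi⟩ := Function.ne_iff.mp hx
  have hxi : x i = 1 := by
    have key : ∀ t : ZMod 2, t ≠ 0 → t = 1 := by decide
    exact key _ hi
  have h1 : Q * tau n (Sum.elim (Pi.single i 1) 0)
      = tau n (Sum.elim (A.mulVec (Pi.single i 1)) 0) * Q := by
    rw [← hQA, Matrix.mul_assoc _ Q Q, hQ2, Matrix.mul_one]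
  rw [tau_diag, tau_diag] at h1
  have h2 := congrFun (congrFun h1 0) x
  rw [Matrix.mul_diagonal, Matrix.diagonal_mul, single_dotProduct, hxi, dotProduct_zero] at h2
  have hv : ((1 : ZMod 2) * 1).val = 1 := by decide
  rw [hv] at h2
  simp at h2
  have h3 : (2 : ℂ) * Q 0 x = 0 := by linear_combination -h2
  simpa using h3

theorem mul_zero_zero (n : ℕ)
    (Q R : Matrix (Fin n → ZMod 2) (Fin n → ZMod 2) ℂ)
    (h : ∀ x, x ≠ 0 → Q 0 x = 0) : (Q * R) 0 0 = Q 0 0 * R 0 0 := by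
  rw [Matrix.mul_apply]
  apply Finset.sum_eq_single
  · intro x _ hx
    rw [h x hx, zero_mul]
  · simp

/-- Sign formula, case `f = f' = 0`: two Clifford involutions `Q, Q'` which
conjugate every `τ_{(a₁,0)}` to `τ_{(A a₁,0)}` resp. `τ_{(A' a₁,0)}` and satisfy
`Q Q' = ± Q' Q` must commute. -/
theorem sign_formula_commute (n : ℕ) (hn : 1 ≤ n)
    (Q Q' : Matrix (Fin n → ZMod 2) (Fin n → ZMod 2) ℂ)
    (hQu : IsUnitaryMat Q) (hQ'u : IsUnitaryMat Q')
    (hQ2 : Q * Q = 1) (hQ'2 : Q' * Q' = 1)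
    (A A' : Matrix (Fin n) (Fin n) (ZMod 2))
    (hQA : ∀ a₁ : Fin n → ZMod 2,
      Q * tau n (Sum.elim a₁ 0) * Q = tau n (Sum.elim (A.mulVec a₁) 0))
    (hQ'A : ∀ a₁ : Fin n → ZMod 2,
      Q' * tau n (Sum.elim a₁ 0) * Q' = tau n (Sum.elim (A'.mulVec a₁) 0))
    (ε : ℂ) (hε : ε = 1 ∨ ε = -1)
    (hcomm : Q * Q' = ε • (Q' * Q)) :
    ε = 1 ∧ Q * Q' = Q' * Q := by
  have hr := row_zero n Q hQ2 A hQA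
  have hr' := row_zero n Q' hQ'2 A' hQ'A
  have e1 := mul_zero_zero n Q Q hr
  have e2 := mul_zero_zero n Q' Q' hr'
  have e3 := mul_zero_zero n Q Q' hr
  have e4 := mul_zero_zero n Q' Q hr'
  rw [hQ2, Matrix.one_apply_eq] at e1
  rw [hQ'2, Matrix.one_apply_eq] at e2
  rw [hcomm, Matrix.smul_apply, e4, smul_eq_mul] at e3
  have h1 : ε = 1 := by
    linear_combination (Q 0 0 * Q' 0 0) * e3 + (ε - 1) * e1 + (ε - 1) * Q 0 0 * Q 0 0 * e2
  refine ⟨h1, ?_⟩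
  rw [hcomm, h1, one_smul]
end

section
/- The third level of the Clifford hierarchy is closed under entrywise complex conjugation: if U ∈ 𝒞_3 on n qubits, then the entrywise complex conjugate Ū (equivalently, since U is unitary, the transpose of U†) also belongs to 𝒞_3. (This rests on the facts, also established, that the Pauli group P_n and the Clifford group 𝒞_2 are closed under entrywise complex conjugation.) -/
open Matrix

theorem conj_unit {n : ℕ} {M : Matrix (Fin n → ZMod 2) (Fin n → ZMod 2) ℂ}
    (h : IsUnitaryMat M) : IsUnitaryMat (M.map (starRingEnd ℂ)) := by
  have e : (M.map (starRingEnd ℂ))ᴴ = Mᴴ.map (starRingEnd ℂ) := by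
    ext i j; simp
  refine ⟨?_, ?_⟩
  · rw [e, ← Matrix.map_mul, h.1]; simp
  · rw [e, ← Matrix.map_mul, h.2]; simp

theorem conj_conj_map {n : ℕ} (M : Matrix (Fin n → ZMod 2) (Fin n → ZMod 2) ℂ) :
    (M.map (starRingEnd ℂ)).map (starRingEnd ℂ) = M := by
  ext i j; simp

theorem conj_sandwich {n : ℕ} (M σ : Matrix (Fin n → ZMod 2) (Fin n → ZMod 2) ℂ) :
    M.map (starRingEnd ℂ) * σ * (M.map (starRingEnd ℂ))ᴴ =
      (M * σ.map (starRingEnd ℂ) * Mᴴ).map (starRingEnd ℂ) := by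
  have e : (M.map (starRingEnd ℂ))ᴴ = Mᴴ.map (starRingEnd ℂ) := by
    ext i j; simp
  rw [Matrix.map_mul, Matrix.map_mul, conj_conj_map, e]

theorem conj_tau (n : ℕ) (a : Fin n ⊕ Fin n → ZMod 2) :
    (tau n a).map (starRingEnd ℂ) = tau n a := by
  ext i j
  simp only [tau, Matrix.map_apply, Matrix.of_apply]
  split_ifs <;> simp

theorem conj_pauli (n : ℕ) : ∀ σ ∈ PauliGroup n, σ.map (starRingEnd ℂ) ∈ PauliGroup n := by
  rintro σ ⟨δ, ε, a, rfl⟩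
  refine ⟨δ, ε + δ, a, ?_⟩
  have h : ((Complex.I ^ δ.val * (-1 : ℂ) ^ ε.val) • tau n a).map (starRingEnd ℂ) =
      (starRingEnd ℂ (Complex.I ^ δ.val * (-1 : ℂ) ^ ε.val)) •
        (tau n a).map (starRingEnd ℂ) := by
    ext i j; simp
  rw [h, conj_tau]
  congr 1
  have hv : (ε + δ).val = (ε.val + δ.val) % 2 := ZMod.val_add ε δ
  have hδ : δ.val = 0 ∨ δ.val = 1 := by have := ZMod.val_lt δ; omega
  have hε : ε.val = 0 ∨ ε.val = 1 := by have := ZMod.val_lt ε; omega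
  rw [hv]
  rcases hδ with h1 | h1 <;> rcases hε with h2 | h2 <;> simp [h1, h2]

/-- The Pauli group, the Clifford group, and the third level of the Clifford
hierarchy are all closed under entrywise complex conjugation. -/
theorem clifford_hierarchy_closed_under_conj (n : ℕ) (hn : 1 ≤ n) :
    (∀ σ ∈ PauliGroup n, σ.map (starRingEnd ℂ) ∈ PauliGroup n) ∧
    (∀ Q ∈ Clifford2 n, Q.map (starRingEnd ℂ) ∈ Clifford2 n) ∧
    (∀ U ∈ Clifford3 n, U.map (starRingEnd ℂ) ∈ Clifford3 n) := by
  have h2 : ∀ Q ∈ Clifford2 n, Q.map (starRingEnd ℂ) ∈ Clifford2 n := by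
    rintro Q ⟨hu, hQ⟩
    refine ⟨conj_unit hu, fun σ hσ => ?_⟩
    rw [conj_sandwich]
    exact conj_pauli n _ (hQ _ (conj_pauli n _ hσ))
  refine ⟨conj_pauli n, h2, ?_⟩
  rintro U ⟨hu, hU⟩
  refine ⟨conj_unit hu, fun σ hσ => ?_⟩
  rw [conj_sandwich]
  exact h2 _ (hU _ (conj_pauli n _ hσ))
end
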